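/- arXiv:1807.07131 — 3 statements merged into one kernel-verified Lean document; each statement's English description precedes it below -/
import Mathlib

section
/- Suppose Re s_k < 0 for k = 1, …, m, and let ω ⊆ ℂ be open and star-shaped with respect to the origin. If f : ω → ℂ is continuous, then for every t ∈ ω the function σ ↦ (∏_{k=1}^m σ_k^{−s_k−1}) f(σ_1⋯σ_m t) is Lebesgue integrable on [0,1]^m, and H_p f is continuous on ω. If moreover f is holomorphic on ω, then H_p f is holomorphic on ω. -/
open MeasureTheory

/-- The operator `H_p` associated with roots `s_1, …, s_m`:
`(H_p f)(t) = ∫_{[0,1]^m} (∏_k σ_k^{-s_k-1}) f(σ_1⋯σ_m t) dσ`. -/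
noncomputable def Hp {ι : Type*} [Fintype ι] (s : ι → ℂ) (f : ℂ → ℂ) (t : ℂ) : ℂ :=
  ∫ σ : ι → ℝ in Set.Icc 0 1,
    (∏ k, ((σ k : ℂ) ^ (-(s k) - 1))) * f ((∏ k, ((σ k : ℝ) : ℂ)) * t)

/-- The weight `∏_k σ_k ^ (-s_k - 1)` is integrable on the unit cube when all `s_k` have negative
real part. -/
lemma integrableOn_prod_cpow {ι : Type*} [Fintype ι] (s : ι → ℂ) (hs : ∀ k, (s k).re < 0) :
    IntegrableOn (fun σ : ι → ℝ => ∏ k, ((σ k : ℂ) ^ (-(s k) - 1))) (Set.Icc 0 1) := by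
  have hvol : (volume : Measure (ι → ℝ)).restrict (Set.Icc 0 1) =
      Measure.pi fun _ : ι => (volume : Measure ℝ).restrict (Set.Icc 0 1) := by
    rw [← Set.pi_univ_Icc, volume_pi, Measure.restrict_pi_pi]
    rfl
  rw [IntegrableOn, hvol]
  refine Integrable.fintype_prod (f := fun k (x : ℝ) => (x : ℂ) ^ (-(s k) - 1)) fun k => ?_
  have h := intervalIntegral.intervalIntegrable_cpow' (a := 0) (b := 1) (r := -(s k) - 1)
    (by simpa using hs k)
  rwa [intervalIntegrable_iff_integrableOn_Icc_of_le zero_le_one] at h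

section StarShaped

variable {X : Type*} [TopologicalSpace X] [MeasurableSpace X] [OpensMeasurableSpace X]
  {μ : Measure X} {S : Set X} {φ : X → ℝ} {w : X → ℂ} {ω : Set ℂ} {f : ℂ → ℂ}

lemma aestronglyMeasurable_comp_dilation (hS : MeasurableSet S) (hφ : Continuous φ)
    (hφS : ∀ x ∈ S, φ x ∈ Set.Icc (0 : ℝ) 1)
    (hstar : ∀ t ∈ ω, ∀ σ : ℝ, 0 ≤ σ → σ ≤ 1 → (σ : ℂ) * t ∈ ω)
    (hf : ContinuousOn f ω) {t : ℂ} (ht : t ∈ ω) :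
    AEStronglyMeasurable (fun x => f (φ x * t)) (μ.restrict S) := by
  refine ContinuousOn.aestronglyMeasurable ?_ hS
  exact hf.comp (by fun_prop) fun x hx => hstar t ht _ (hφS x hx).1 (hφS x hx).2

/-- A continuous function on a star-shaped open set is bounded on all dilations, by factors in
`[0,1]`, of a small ball. -/
lemma exists_ball_bound_comp_dilation (hω : IsOpen ω)
    (hstar : ∀ t ∈ ω, ∀ σ : ℝ, 0 ≤ σ → σ ≤ 1 → (σ : ℂ) * t ∈ ω)
    (hf : ContinuousOn f ω) {t₀ : ℂ} (ht₀ : t₀ ∈ ω) :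
    ∃ r > 0, Metric.ball t₀ r ⊆ ω ∧
      ∃ C, ∀ σ ∈ Set.Icc (0 : ℝ) 1, ∀ t ∈ Metric.ball t₀ r, ‖f (σ * t)‖ ≤ C := by
  obtain ⟨r, hr, hrω⟩ := Metric.nhds_basis_closedBall.mem_iff.1 (hω.mem_nhds ht₀)
  have hK : IsCompact (Set.Icc (0 : ℝ) 1 ×ˢ Metric.closedBall t₀ r) :=
    isCompact_Icc.prod (isCompact_closedBall t₀ r)
  have hc : ContinuousOn (fun p : ℝ × ℂ => f (p.1 * p.2))
      (Set.Icc (0 : ℝ) 1 ×ˢ Metric.closedBall t₀ r) :=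
    hf.comp (by fun_prop) fun p hp => hstar _ (hrω hp.2) _ hp.1.1 hp.1.2
  obtain ⟨C, hC⟩ := hK.exists_bound_of_continuousOn hc
  exact ⟨r, hr, Metric.ball_subset_closedBall.trans hrω, C, fun σ hσ t ht =>
    hC (σ, t) ⟨hσ, Metric.ball_subset_closedBall ht⟩⟩

lemma integrableOn_mul_comp_dilation (hS : MeasurableSet S) (hφ : Continuous φ)
    (hφS : ∀ x ∈ S, φ x ∈ Set.Icc (0 : ℝ) 1) (hw : IntegrableOn w S μ) (hω : IsOpen ω)
    (hstar : ∀ t ∈ ω, ∀ σ : ℝ, 0 ≤ σ → σ ≤ 1 → (σ : ℂ) * t ∈ ω)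
    (hf : ContinuousOn f ω) {t : ℂ} (ht : t ∈ ω) :
    IntegrableOn (fun x => w x * f (φ x * t)) S μ := by
  obtain ⟨r, hr, -, C, hC⟩ := exists_ball_bound_comp_dilation hω hstar hf ht
  refine Integrable.mul_bdd (c := C) hw
    (aestronglyMeasurable_comp_dilation hS hφ hφS hstar hf ht) ?_
  filter_upwards [ae_restrict_mem hS] with x hx
  exact hC _ (hφS x hx) t (Metric.mem_ball_self hr)

lemma continuousOn_integral_mul_comp_dilation (hS : MeasurableSet S) (hφ : Continuous φ)
    (hφS : ∀ x ∈ S, φ x ∈ Set.Icc (0 : ℝ) 1) (hw : IntegrableOn w S μ) (hω : IsOpen ω)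
    (hstar : ∀ t ∈ ω, ∀ σ : ℝ, 0 ≤ σ → σ ≤ 1 → (σ : ℂ) * t ∈ ω)
    (hf : ContinuousOn f ω) :
    ContinuousOn (fun t => ∫ x in S, w x * f (φ x * t) ∂μ) ω := by
  intro t₀ ht₀
  refine ContinuousAt.continuousWithinAt ?_
  obtain ⟨r, hr, hrω, C, hC⟩ := exists_ball_bound_comp_dilation hω hstar hf ht₀
  have hball := Metric.ball_mem_nhds t₀ hr
  refine continuousAt_of_dominated (bound := fun x => ‖w x‖ * C) ?_ ?_ (hw.norm.mul_const C) ?_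
  · filter_upwards [hball] with t ht
    exact hw.aestronglyMeasurable.mul
      (aestronglyMeasurable_comp_dilation hS hφ hφS hstar hf (hrω ht))
  · filter_upwards [hball] with t ht
    filter_upwards [ae_restrict_mem hS] with x hx
    rw [norm_mul]
    gcongr
    exact hC _ (hφS x hx) t ht
  · filter_upwards [ae_restrict_mem hS] with x hx
    have hfx : ContinuousAt f (φ x * t₀) :=
      hf.continuousAt (hω.mem_nhds (hstar t₀ ht₀ _ (hφS x hx).1 (hφS x hx).2))
    exact continuousAt_const.mul (ContinuousAt.comp' hfx (by fun_prop))

lemma differentiableOn_integral_mul_comp_dilation (hS : MeasurableSet S) (hφ : Continuous φ)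
    (hφS : ∀ x ∈ S, φ x ∈ Set.Icc (0 : ℝ) 1) (hw : IntegrableOn w S μ) (hω : IsOpen ω)
    (hstar : ∀ t ∈ ω, ∀ σ : ℝ, 0 ≤ σ → σ ≤ 1 → (σ : ℂ) * t ∈ ω)
    (hf : DifferentiableOn ℂ f ω) :
    DifferentiableOn ℂ (fun t => ∫ x in S, w x * f (φ x * t) ∂μ) ω := by
  intro t₀ ht₀
  refine DifferentiableAt.differentiableWithinAt ?_
  have hf' : ContinuousOn (deriv f) ω := (hf.deriv hω).continuousOn
  obtain ⟨r, hr, hrω, C, hC⟩ := exists_ball_bound_comp_dilation hω hstar hf' ht₀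
  have hball := Metric.ball_mem_nhds t₀ hr
  refine (hasDerivAt_integral_of_dominated_loc_of_deriv_le
    (μ := μ.restrict S) (F := fun t x => w x * f (φ x * t))
    (F' := fun t x => w x * (deriv f (φ x * t) * φ x))
    (bound := fun x => ‖w x‖ * C) hball ?_
    (integrableOn_mul_comp_dilation hS hφ hφS hw hω hstar hf.continuousOn ht₀) ?_ ?_
    (hw.norm.mul_const C) ?_).2.differentiableAt
  · filter_upwards [hball] with t ht
    exact hw.aestronglyMeasurable.mul
      (aestronglyMeasurable_comp_dilation hS hφ hφS hstar hf.continuousOn (hrω ht))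
  · refine hw.aestronglyMeasurable.mul
      ((aestronglyMeasurable_comp_dilation hS hφ hφS hstar hf' ht₀).mul ?_)
    exact ContinuousOn.aestronglyMeasurable (by fun_prop) hS
  · filter_upwards [ae_restrict_mem hS] with x hx t ht
    have hC' := hC _ (hφS x hx) t ht
    have hφ1 : ‖(φ x : ℂ)‖ ≤ 1 := by
      rw [Complex.norm_real, Real.norm_of_nonneg (hφS x hx).1]
      exact (hφS x hx).2
    rw [norm_mul, norm_mul]
    gcongr
    exact (mul_le_of_le_one_right (norm_nonneg _) hφ1).trans hC'
  · filter_upwards [ae_restrict_mem hS] with x hx t ht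
    have hfx : HasDerivAt f (deriv f (φ x * t)) (φ x * t) :=
      (hf.differentiableAt
        (hω.mem_nhds (hstar t (hrω ht) _ (hφS x hx).1 (hφS x hx).2))).hasDerivAt
    exact (hfx.comp t (by simpa using (hasDerivAt_id t).const_mul (φ x : ℂ))).const_mul (w x)

end StarShaped

theorem statement0 (m : ℕ) (hm : 1 ≤ m) (s : Fin m → ℂ) (hs : ∀ k, (s k).re < 0)
    (ω : Set ℂ) (hω : IsOpen ω)
    (hstar : ∀ t ∈ ω, ∀ σ : ℝ, 0 ≤ σ → σ ≤ 1 → (σ : ℂ) * t ∈ ω)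
    (f : ℂ → ℂ) (hf : ContinuousOn f ω) :
    (∀ t ∈ ω, IntegrableOn
        (fun σ : Fin m → ℝ =>
          (∏ k, ((σ k : ℂ) ^ (-(s k) - 1))) * f ((∏ k, ((σ k : ℝ) : ℂ)) * t))
        (Set.Icc 0 1)) ∧
    ContinuousOn (Hp s f) ω ∧
    (DifferentiableOn ℂ f ω → DifferentiableOn ℂ (Hp s f) ω) := by
  have hw := integrableOn_prod_cpow s hs
  have hφ : Continuous fun σ : Fin m → ℝ => ∏ k, σ k := by fun_prop
  have hφS : ∀ σ ∈ Set.Icc (0 : Fin m → ℝ) 1, ∏ k, σ k ∈ Set.Icc (0 : ℝ) 1 := fun σ hσ =>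
    ⟨Finset.prod_nonneg fun k _ => hσ.1 k,
      Finset.prod_le_one (fun k _ => hσ.1 k) fun k _ => hσ.2 k⟩
  have hHp : Hp s f = fun t => ∫ σ : Fin m → ℝ in Set.Icc 0 1,
      (∏ k, ((σ k : ℂ) ^ (-(s k) - 1))) * f ((∏ k, σ k : ℝ) * t) := by
    funext t
    simp only [Hp, Complex.ofReal_prod]
  rw [hHp]
  refine ⟨fun t ht => ?_,
    continuousOn_integral_mul_comp_dilation measurableSet_Icc hφ hφS hw hω hstar hf,
    differentiableOn_integral_mul_comp_dilation measurableSet_Icc hφ hφS hw hω hstar⟩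
  simpa only [Complex.ofReal_prod] using
    integrableOn_mul_comp_dilation measurableSet_Icc hφ hφS hw hω hstar hf ht
end

section
/- Suppose Re s_k < 0 for k = 1, …, m, let ω ⊆ ℂ be open and star-shaped with respect to the origin, and let f be holomorphic on ω. Set q(s) = ∏_{k=2}^m (s − s_k) (so q = 1 if m = 1). Then for every t ∈ ω one has t·(H_p f)′(t) = s_1·(H_p f)(t) + (H_q f)(t). -/
open MeasureTheory

open Set Filter Topology

/-- The measure of integration in `Hp`, written as a product of measures on `[0,1]`. -/
lemma volume_restrict_Icc_pi {ι : Type*} [Fintype ι] :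
    (volume : Measure (ι → ℝ)).restrict (Icc 0 1) =
      Measure.pi (fun _ : ι => (volume : Measure ℝ).restrict (Icc 0 1)) := by
  rw [← Measure.restrict_pi_pi, ← volume_pi]
  congr 1
  exact (pi_univ_Icc (0 : ι → ℝ) 1).symm

/-- If `g` is continuous on a star-shaped set and `c` takes values in `[0,1]`, then
`a ↦ g (c a * t)` is almost everywhere strongly measurable. -/
lemma aestronglyMeasurable_comp_dilation_s2 {α : Type*} [MeasurableSpace α] {μ : Measure α}
    {c : α → ℝ} (hc : Measurable c) (hc01 : ∀ᵐ a ∂μ, c a ∈ Icc (0 : ℝ) 1)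
    {ω : Set ℂ} (hstar : ∀ t ∈ ω, ∀ σ : ℝ, 0 ≤ σ → σ ≤ 1 → (σ : ℂ) * t ∈ ω)
    {g : ℂ → ℂ} (hg : ContinuousOn g ω) {t : ℂ} (ht : t ∈ ω) :
    AEStronglyMeasurable (fun a => g ((c a : ℂ) * t)) μ := by
  have hcont : Continuous fun x : ℝ => g (((max 0 (min 1 x) : ℝ) : ℂ) * t) :=
    hg.comp_continuous (by fun_prop)
      fun x => hstar t ht _ (le_max_left _ _) (max_le zero_le_one (min_le_left _ _))
  refine (hcont.measurable.comp hc).aestronglyMeasurable.congr ?_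
  filter_upwards [hc01] with a ha
  simp only [Function.comp_apply, min_eq_right ha.2, max_eq_right ha.1]

/-- A function continuous on an open star-shaped set is bounded on all dilates, with factor in
`[0,1]`, of some neighbourhood of a given point. -/
lemma exists_bound_dilation {ω : Set ℂ} (hω : IsOpen ω)
    (hstar : ∀ t ∈ ω, ∀ σ : ℝ, 0 ≤ σ → σ ≤ 1 → (σ : ℂ) * t ∈ ω)
    {g : ℂ → ℂ} (hg : ContinuousOn g ω) {t : ℂ} (ht : t ∈ ω) :
    ∃ U ∈ 𝓝 t, U ⊆ ω ∧ ∃ C, ∀ x ∈ U, ∀ σ ∈ Icc (0 : ℝ) 1, ‖g ((σ : ℂ) * x)‖ ≤ C := by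
  obtain ⟨U, hU, hUω, hUc⟩ := local_compact_nhds (hω.mem_nhds ht)
  have hK : IsCompact (Icc (0 : ℝ) 1 ×ˢ U) := isCompact_Icc.prod hUc
  have hcont : ContinuousOn (fun p : ℝ × ℂ => g ((p.1 : ℂ) * p.2)) (Icc (0 : ℝ) 1 ×ˢ U) :=
    hg.comp (by fun_prop) fun p hp => hstar _ (hUω hp.2) _ hp.1.1 hp.1.2
  obtain ⟨C, hC⟩ := hK.exists_bound_of_continuousOn hcont
  exact ⟨U, hU, hUω, C, fun x hx σ hσ => hC (σ, x) ⟨hσ, hx⟩⟩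

lemma integrable_mul_comp_dilation {α : Type*} [MeasurableSpace α] {μ : Measure α}
    {w : α → ℂ} (hw : Integrable w μ)
    {c : α → ℝ} (hc : Measurable c) (hc01 : ∀ᵐ a ∂μ, c a ∈ Icc (0 : ℝ) 1)
    {ω : Set ℂ} (hω : IsOpen ω)
    (hstar : ∀ t ∈ ω, ∀ σ : ℝ, 0 ≤ σ → σ ≤ 1 → (σ : ℂ) * t ∈ ω)
    {g : ℂ → ℂ} (hg : ContinuousOn g ω) {t : ℂ} (ht : t ∈ ω) :
    Integrable (fun a => w a * g ((c a : ℂ) * t)) μ := by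
  obtain ⟨U, hU, -, C, hC⟩ := exists_bound_dilation hω hstar hg ht
  refine hw.mul_bdd (c := C) (aestronglyMeasurable_comp_dilation_s2 hc hc01 hstar hg ht) ?_
  filter_upwards [hc01] with a ha
  exact hC t (mem_of_mem_nhds hU) _ ha

/-- Differentiation under the integral sign for weighted averages of dilations. -/
lemma hasDerivAt_integral_mul_comp_dilation {α : Type*} [MeasurableSpace α] {μ : Measure α}
    {w : α → ℂ} (hw : Integrable w μ)
    {c : α → ℝ} (hc : Measurable c) (hc01 : ∀ᵐ a ∂μ, c a ∈ Icc (0 : ℝ) 1)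
    {ω : Set ℂ} (hω : IsOpen ω)
    (hstar : ∀ t ∈ ω, ∀ σ : ℝ, 0 ≤ σ → σ ≤ 1 → (σ : ℂ) * t ∈ ω)
    {g : ℂ → ℂ} (hg : DifferentiableOn ℂ g ω) {t : ℂ} (ht : t ∈ ω) :
    HasDerivAt (fun x => ∫ a, w a * g ((c a : ℂ) * x) ∂μ)
      (∫ a, w a * (c a * deriv g ((c a : ℂ) * t)) ∂μ) t := by
  have hg' : ContinuousOn (deriv g) ω := (hg.deriv hω).continuousOn
  obtain ⟨U, hU, hUω, C, hC⟩ := exists_bound_dilation hω hstar hg' ht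
  refine (hasDerivAt_integral_of_dominated_loc_of_deriv_le
    (F := fun x a => w a * g ((c a : ℂ) * x))
    (F' := fun x a => w a * (c a * deriv g ((c a : ℂ) * x)))
    (bound := fun a => ‖w a‖ * C) hU ?_
    (integrable_mul_comp_dilation hw hc hc01 hω hstar hg.continuousOn ht) ?_ ?_
    (hw.norm.mul_const C) ?_).2
  · filter_upwards [hω.mem_nhds ht] with x hx
    exact (integrable_mul_comp_dilation hw hc hc01 hω hstar hg.continuousOn hx).1
  · exact hw.1.mul ((Complex.measurable_ofReal.comp hc).aestronglyMeasurable.mul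
      (aestronglyMeasurable_comp_dilation_s2 hc hc01 hstar hg' ht))
  · filter_upwards [hc01] with a ha x hx
    rw [norm_mul, norm_mul, Complex.norm_real, Real.norm_of_nonneg ha.1]
    gcongr
    calc c a * ‖deriv g (c a * x)‖ ≤ 1 * ‖deriv g (c a * x)‖ := by gcongr; exact ha.2
      _ ≤ C := by rw [one_mul]; exact hC x hx _ ha
  · filter_upwards [hc01] with a ha x hx
    have hd : HasDerivAt g (deriv g (c a * x)) (c a * x) :=
      (hg.differentiableAt (hω.mem_nhds (hstar x (hUω hx) _ ha.1 ha.2))).hasDerivAt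
    have hl : HasDerivAt (fun y : ℂ => (c a : ℂ) * y) (c a) x := by
      simpa using (hasDerivAt_id x).const_mul (c a : ℂ)
    refine HasDerivAt.congr_deriv ((hd.comp x hl).const_mul (w a)) ?_
    ring

lemma integrable_cpow_restrict_Icc {z : ℂ} (hz : z.re < 0) :
    Integrable (fun x : ℝ => (x : ℂ) ^ (-z - 1)) (volume.restrict (Icc (0 : ℝ) 1)) := by
  have h := intervalIntegral.intervalIntegrable_cpow' (a := 0) (b := 1) (r := -z - 1)
    (by simp; linarith)
  rw [intervalIntegrable_iff_integrableOn_Icc_of_le zero_le_one] at h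
  exact h

lemma integrable_prod_cpow {ι : Type*} [Fintype ι] {s : ι → ℂ} (hs : ∀ k, (s k).re < 0) :
    Integrable (fun σ : ι → ℝ => ∏ k, ((σ k : ℂ) ^ (-(s k) - 1)))
      (volume.restrict (Icc (0 : ι → ℝ) 1)) := by
  rw [volume_restrict_Icc_pi]
  exact Integrable.fintype_prod (f := fun k (x : ℝ) => (x : ℂ) ^ (-(s k) - 1))
    fun k => integrable_cpow_restrict_Icc (hs k)

lemma ae_prod_mem_Icc {ι : Type*} [Fintype ι] :
    ∀ᵐ σ ∂(volume.restrict (Icc (0 : ι → ℝ) 1)), ∏ k, σ k ∈ Icc (0 : ℝ) 1 := by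
  filter_upwards [ae_restrict_mem measurableSet_Icc] with σ hσ
  exact ⟨Finset.prod_nonneg fun k _ => hσ.1 k,
    Finset.prod_le_one (fun k _ => hσ.1 k) fun k _ => hσ.2 k⟩

lemma Hp_eq_integral {ι : Type*} [Fintype ι] (s : ι → ℂ) (f : ℂ → ℂ) (t : ℂ) :
    Hp s f t = ∫ σ : ι → ℝ in Icc 0 1,
      (∏ k, ((σ k : ℂ) ^ (-(s k) - 1))) * f (((∏ k, σ k : ℝ) : ℂ) * t) := by
  simp only [Hp, Complex.ofReal_prod]

lemma differentiableOn_Hp {ι : Type*} [Fintype ι] {s : ι → ℂ} (hs : ∀ k, (s k).re < 0)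
    {ω : Set ℂ} (hω : IsOpen ω)
    (hstar : ∀ t ∈ ω, ∀ σ : ℝ, 0 ≤ σ → σ ≤ 1 → (σ : ℂ) * t ∈ ω)
    {f : ℂ → ℂ} (hf : DifferentiableOn ℂ f ω) : DifferentiableOn ℂ (Hp s f) ω := by
  intro t ht
  rw [funext (Hp_eq_integral s f)]
  exact (hasDerivAt_integral_mul_comp_dilation (integrable_prod_cpow hs) (by fun_prop)
    ae_prod_mem_Icc hω hstar hf ht).differentiableAt.differentiableWithinAt

/-- Fubini: the operator with roots `s 0, …, s m` is the one-variable operator with root `s 0`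
applied to the operator with the remaining roots. -/
lemma Hp_succ {m : ℕ} {s : Fin (m + 1) → ℂ} (hs : ∀ k, (s k).re < 0)
    {ω : Set ℂ} (hω : IsOpen ω)
    (hstar : ∀ t ∈ ω, ∀ σ : ℝ, 0 ≤ σ → σ ≤ 1 → (σ : ℂ) * t ∈ ω)
    {f : ℂ → ℂ} (hf : DifferentiableOn ℂ f ω) {t : ℂ} (ht : t ∈ ω) :
    Hp s f t = ∫ x : ℝ in Icc 0 1,
      (x : ℂ) ^ (-(s 0) - 1) * Hp (fun k : Fin m => s k.succ) f ((x : ℂ) * t) := by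
  have hint := integrable_mul_comp_dilation (integrable_prod_cpow hs) (c := fun σ => ∏ k, σ k)
    (by fun_prop) ae_prod_mem_Icc hω hstar hf.continuousOn ht
  have hmp := (measurePreserving_piFinSuccAbove
    (fun _ : Fin (m + 1) => (volume : Measure ℝ).restrict (Icc 0 1)) 0).symm
  rw [Hp_eq_integral]
  rw [volume_restrict_Icc_pi] at hint ⊢
  rw [← hmp.integrable_comp_emb (MeasurableEquiv.measurableEmbedding _)] at hint
  rw [← hmp.integral_comp', integral_prod]
  swap
  · exact hint
  refine integral_congr_ae (Eventually.of_forall fun x => ?_)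
  simp only [Hp]
  rw [volume_restrict_Icc_pi, ← integral_const_mul]
  refine integral_congr_ae (Eventually.of_forall fun σ => ?_)
  simp only [MeasurableEquiv.piFinSuccAbove_symm_apply, Fin.insertNthEquiv, Equiv.coe_fn_mk,
    Fin.prod_univ_succ, Fin.insertNth_zero, Fin.cons_zero, Fin.cons_succ, cast_eq,
    Complex.ofReal_mul, Complex.ofReal_prod]
  ring_nf

/-- Integration by parts for the one-variable operator. -/
lemma mul_integral_cpow_mul_deriv {z : ℂ} (hz : z.re < 0) {ω : Set ℂ} (hω : IsOpen ω)
    (hstar : ∀ t ∈ ω, ∀ σ : ℝ, 0 ≤ σ → σ ≤ 1 → (σ : ℂ) * t ∈ ω)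
    {g : ℂ → ℂ} (hg : DifferentiableOn ℂ g ω) {t : ℂ} (ht : t ∈ ω) :
    t * ∫ x : ℝ in Icc 0 1, (x : ℂ) ^ (-z - 1) * (x * deriv g ((x : ℂ) * t)) =
      z * (∫ x : ℝ in Icc 0 1, (x : ℂ) ^ (-z - 1) * g ((x : ℂ) * t)) + g t := by
  have hw := integrable_cpow_restrict_Icc hz
  have hmem : ∀ᵐ x ∂(volume.restrict (Icc (0 : ℝ) 1)), x ∈ Icc (0 : ℝ) 1 :=
    ae_restrict_mem measurableSet_Icc
  have hz0 : -z ≠ 0 := by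
    intro h
    rw [neg_eq_zero.mp h] at hz
    simp at hz
  have hI : Integrable (fun x : ℝ => (x : ℂ) ^ (-z - 1) * g ((x : ℂ) * t))
      (volume.restrict (Icc (0 : ℝ) 1)) :=
    integrable_mul_comp_dilation hw measurable_id hmem hω hstar hg.continuousOn ht
  have hJ : Integrable (fun x : ℝ => (x : ℂ) ^ (-z - 1) * (x * deriv g ((x : ℂ) * t)))
      (volume.restrict (Icc (0 : ℝ) 1)) := by
    have hxw : Integrable (fun x : ℝ => (x : ℂ) ^ (-z - 1) * x)
        (volume.restrict (Icc (0 : ℝ) 1)) := by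
      refine hw.mul_bdd (c := 1) Complex.measurable_ofReal.aestronglyMeasurable ?_
      filter_upwards [hmem] with x hx
      rw [Complex.norm_real, Real.norm_of_nonneg hx.1]
      exact hx.2
    simpa only [mul_assoc, id] using integrable_mul_comp_dilation hxw measurable_id hmem hω hstar
      (hg.deriv hω).continuousOn ht
  have hpt : ∀ x ∈ Icc (0 : ℝ) 1, (x : ℂ) * t ∈ ω := fun x hx => hstar t ht x hx.1 hx.2
  have hftc := intervalIntegral.integral_eq_sub_of_hasDerivAt_of_le (a := (0 : ℝ)) (b := 1)
    (f := fun x : ℝ => (x : ℂ) ^ (-z) * g ((x : ℂ) * t))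
    (f' := fun x : ℝ => t * ((x : ℂ) ^ (-z - 1) * (x * deriv g ((x : ℂ) * t)))
      - z * ((x : ℂ) ^ (-z - 1) * g ((x : ℂ) * t))) zero_le_one ?_ ?_ ?_
  · rw [intervalIntegral.integral_of_le zero_le_one, ← integral_Icc_eq_integral_Ioc,
      integral_sub (hJ.const_mul t) (hI.const_mul z), integral_const_mul, integral_const_mul] at hftc
    simp only [Complex.ofReal_one, Complex.one_cpow, one_mul, Complex.ofReal_zero,
      Complex.zero_cpow hz0, zero_mul, sub_zero] at hftc
    linear_combination hftc
  · refine (Complex.continuous_ofReal_cpow_const (by simpa using hz)).continuousOn.mul ?_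
    exact hg.continuousOn.comp (by fun_prop) hpt
  · intro x hx
    have hx0 : (x : ℂ) ≠ 0 := Complex.ofReal_ne_zero.mpr hx.1.ne'
    have hp := hasDerivAt_ofReal_cpow_const hx.1.ne' hz0
    have hd : HasDerivAt g (deriv g (x * t)) (x * t) :=
      (hg.differentiableAt (hω.mem_nhds (hpt x ⟨hx.1.le, hx.2.le⟩))).hasDerivAt
    have hl : HasDerivAt (fun y : ℂ => y * t) t (x : ℂ) := by
      simpa using (hasDerivAt_id (x : ℂ)).mul_const t
    have hgl : HasDerivAt (fun y : ℝ => g ((y : ℂ) * t)) (deriv g (x * t) * t) x :=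
      (hd.comp (x : ℂ) hl).comp_ofReal
    refine HasDerivAt.congr_deriv (hp.mul hgl) ?_
    rw [Complex.cpow_sub _ _ hx0, Complex.cpow_one]
    field_simp
    ring
  · rw [intervalIntegrable_iff_integrableOn_Icc_of_le zero_le_one]
    exact (hJ.const_mul t).sub (hI.const_mul z)

/-- For `p` with roots `s_0, …, s_m` (so `m + 1 ≥ 1` roots) and `q` with roots
`s_1, …, s_m`, one has `t (H_p f)'(t) = s_0 (H_p f)(t) + (H_q f)(t)` on a
star-shaped open set `ω` for holomorphic `f`. -/
theorem statement2 (m : ℕ) (s : Fin (m + 1) → ℂ) (hs : ∀ k, (s k).re < 0)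
    (ω : Set ℂ) (hω : IsOpen ω)
    (hstar : ∀ t ∈ ω, ∀ σ : ℝ, 0 ≤ σ → σ ≤ 1 → (σ : ℂ) * t ∈ ω)
    (f : ℂ → ℂ) (hf : DifferentiableOn ℂ f ω) :
    ∀ t ∈ ω, t * deriv (Hp s f) t = s 0 * Hp s f t + Hp (fun k : Fin m => s k.succ) f t := by
  intro t ht
  have hs' : ∀ k : Fin m, (s k.succ).re < 0 := fun k => hs k.succ
  have hq : DifferentiableOn ℂ (Hp (fun k : Fin m => s k.succ) f) ω :=
    differentiableOn_Hp hs' hω hstar hf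
  have heq : Hp s f =ᶠ[𝓝 t] fun x => ∫ a : ℝ in Icc 0 1,
      (a : ℂ) ^ (-(s 0) - 1) * Hp (fun k : Fin m => s k.succ) f ((a : ℂ) * x) := by
    filter_upwards [hω.mem_nhds ht] with x hx
    exact Hp_succ hs hω hstar hf hx
  have hderiv := hasDerivAt_integral_mul_comp_dilation (integrable_cpow_restrict_Icc (hs 0))
    measurable_id (ae_restrict_mem measurableSet_Icc) hω hstar hq ht
  simp only [id] at hderiv
  rw [heq.deriv_eq, hderiv.deriv, Hp_succ hs hω hstar hf ht]
  exact mul_integral_cpow_mul_deriv (hs 0) hω hstar hq ht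
end

section
/- Let m ≥ 1, n ≥ 0, ρ_1 > 0. Let Ω ⊆ ℂ^n be open and bounded and let Ω_1 be an open neighbourhood of the closure of Ω. Let p ∈ ℂ[s] be monic of degree m with p(k) ≠ 0 for every integer k ≥ 0. For every multi-index α ∈ ℕ^n and integer j ≥ 0 with |α| + j ≤ m, let a_{α,j} be a holomorphic function on D_{ρ_1} × Ω_1. Define, for u holomorphic on an open subset of ℂ × ℂ^n, (Pu)(t,x) = p(θ_t)u(t,x) + t·∑_{|α|+j ≤ m} a_{α,j}(t,x)·∂_x^α θ_t^j u(t,x). Then there exists ρ ∈ (0, ρ_1) with the following property: for every open set ω ⊆ D_ρ that is star-shaped with respect to the origin and every holomorphic function f on ω × Ω_1, there exists a unique holomorphic function u : ω × Ω → ℂ satisfying Pu = f on ω × Ω. -/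
open MeasureTheory Polynomial

/-- The Euler operator in the variable `t`: `(θ_t u)(t,x) = t·∂_t u(t,x)`. -/
noncomputable def thetaT {n : ℕ} (u : ℂ → (Fin n → ℂ) → ℂ) : ℂ → (Fin n → ℂ) → ℂ :=
  fun t x => t * deriv (fun τ => u τ x) t

/-- The partial derivative `∂_{x_k}` in the variables `x ∈ ℂ^n`. -/
noncomputable def partialX {n : ℕ} (k : Fin n) (u : ℂ → (Fin n → ℂ) → ℂ) :
    ℂ → (Fin n → ℂ) → ℂ :=
  fun t x => deriv (fun z => u t (Function.update x k z)) (x k)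

/-- The iterated partial derivative `∂_x^α = ∂_{x_1}^{α_1}⋯∂_{x_n}^{α_n}`. -/
noncomputable def partialPow {n : ℕ} (α : Fin n → ℕ) (u : ℂ → (Fin n → ℂ) → ℂ) :
    ℂ → (Fin n → ℂ) → ℂ :=
  (List.finRange n).foldr (fun k v => (partialX k)^[α k] v) u

/-- The Fuchsian type operator
`(Pu)(t,x) = p(θ_t)u(t,x) + t·∑_{|α|+j ≤ m} a_{α,j}(t,x)·∂_x^α θ_t^j u(t,x)`. -/
noncomputable def fuchsOp {n : ℕ} (m : ℕ) (p : Polynomial ℂ)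
    (a : (Fin n → ℕ) → ℕ → ℂ → (Fin n → ℂ) → ℂ) (u : ℂ → (Fin n → ℂ) → ℂ) :
    ℂ → (Fin n → ℂ) → ℂ := fun t x =>
  (∑ j ∈ Finset.range (p.natDegree + 1), p.coeff j * (thetaT^[j] u) t x)
    + t * ∑ j ∈ Finset.range (m + 1),
        ∑ α ∈ Fintype.piFinset (fun _ : Fin n => Finset.range (m + 1)),
          if (∑ i, α i) + j ≤ m then a α j t x * (partialPow α (thetaT^[j] u)) t x else 0

section

open Set Metric Filter Topology

section Holomorphic

variable {E : Type*} [NormedAddCommGroup E] [NormedSpace ℂ E]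

/-- Cauchy estimate for the Fréchet derivative of a bounded holomorphic function on a ball. -/
theorem norm_fderiv_le_of_bound_on_ball {f : E → ℂ} {q : E} {R M : ℝ} (hR : 0 < R)
    (hf : DifferentiableOn ℂ f (ball q R)) (hM : ∀ y ∈ ball q R, ‖f y‖ ≤ M) :
    ‖fderiv ℂ f q‖ ≤ (M + M) / R := by
  refine Complex.norm_fderiv_le_div_of_mapsTo_ball hf (fun y hy => ?_) hR
  rw [mem_closedBall, dist_eq_norm]
  exact (norm_sub_le _ _).trans (add_le_add (hM y hy) (hM q (mem_ball_self hR)))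

variable [FiniteDimensional ℂ E]

/-- An interval integral of affine pullbacks of a holomorphic function is holomorphic in the
parameter. -/
theorem differentiableAt_integral_comp_affine {f : E → ℂ} {U : Set E} (hU : IsOpen U)
    (hf : DifferentiableOn ℂ f U) {a b : ℝ} {w : ℝ → ℂ} (hw : IntervalIntegrable w volume a b)
    {L : ℝ → E →L[ℂ] E} (hL : Continuous L) {c : ℝ → E} (hc : Continuous c) {q₀ : E}
    (hq : ∀ s ∈ uIcc a b, L s q₀ + c s ∈ U) :
    DifferentiableAt ℂ (fun q => ∫ s in a..b, w s * f (L s q + c s)) q₀ := by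
  have : ProperSpace E := FiniteDimensional.proper ℂ E
  borelize E
  have hcont : ∀ q, Continuous fun s => L s q + c s := fun q => by fun_prop
  set C : Set E := (fun s => L s q₀ + c s) '' uIcc a b with hC
  have hCc : IsCompact C := isCompact_uIcc.image (hcont q₀)
  have hCU : C ⊆ U := by rintro _ ⟨s, hs, rfl⟩; exact hq s hs
  obtain ⟨δ, hδ, hδU⟩ := hCc.exists_cthickening_subset_open hU hCU
  obtain ⟨M, hM⟩ := (hCc.cthickening (r := δ)).exists_bound_of_continuousOn
    (hf.continuousOn.mono hδU)
  obtain ⟨B, hB⟩ := (isCompact_uIcc (a := a) (b := b)).exists_bound_of_continuousOn hL.continuousOn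
  have hB0 : 0 ≤ B := (norm_nonneg _).trans (hB a left_mem_uIcc)
  set ε := δ / (2 * (B + 1)) with hε
  have hε0 : 0 < ε := by positivity
  have hnear : ∀ s ∈ uIcc a b, ∀ q ∈ ball q₀ ε, ∀ y ∈ ball (L s q + c s) (δ / 2),
      y ∈ cthickening δ C := by
    intro s hs q hq y hy
    refine mem_cthickening_of_dist_le y (L s q₀ + c s) δ C ⟨s, hs, rfl⟩ ?_
    have h1 : dist (L s q + c s) (L s q₀ + c s) ≤ δ / 2 := by
      rw [dist_add_right, dist_eq_norm, ← map_sub]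
      calc ‖L s (q - q₀)‖ ≤ ‖L s‖ * ‖q - q₀‖ := (L s).le_opNorm _
        _ ≤ (B + 1) * ε := by
          gcongr
          · exact (hB s hs).trans (by linarith)
          · exact (mem_ball_iff_norm.1 hq).le
        _ = δ / 2 := by rw [hε]; field_simp
    linarith [dist_triangle y (L s q + c s) (L s q₀ + c s), mem_ball.1 hy]
  have hmemU : ∀ s ∈ uIcc a b, ∀ q ∈ ball q₀ ε, L s q + c s ∈ U := fun s hs q hq =>
    hδU (hnear s hs q hq _ (mem_ball_self (by positivity)))
  have hFd : ∀ s ∈ uIcc a b, ∀ q ∈ ball q₀ ε, HasFDerivAt f (fderiv ℂ f (L s q + c s))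
      (L s q + c s) := fun s hs q hq =>
    (hf.differentiableAt (hU.mem_nhds (hmemU s hs q hq))).hasFDerivAt
  have hfc : ∀ q ∈ ball q₀ ε, ContinuousOn (fun s => f (L s q + c s)) (uIcc a b) := fun q hq =>
    hf.continuousOn.comp (hcont q).continuousOn fun s hs => hmemU s hs q hq
  have hintegrable : ∀ q ∈ ball q₀ ε, IntervalIntegrable (fun s => w s * f (L s q + c s)) volume a b :=
    fun q hq => hw.mul_continuousOn (hfc q hq)
  refine (intervalIntegral.hasFDerivAt_integral_of_dominated_of_fderiv_le
    (F' := fun q s => w s • (fderiv ℂ f (L s q + c s)).comp (L s))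
    (bound := fun s => ‖w s‖ * ((M + M) / (δ / 2) * B)) (ball_mem_nhds q₀ hε0) ?_
    (hintegrable q₀ (mem_ball_self hε0)) ?_ ?_ ?_ ?_).differentiableAt
  · filter_upwards [ball_mem_nhds q₀ hε0] with q hq
    exact (intervalIntegrable_iff.1 (hintegrable q hq)).aestronglyMeasurable
  · refine (intervalIntegrable_iff.1 hw).aestronglyMeasurable.smul ?_
    have h1 : AEStronglyMeasurable (fun s => fderiv ℂ f (L s q₀ + c s))
        (volume.restrict (uIoc a b)) :=
      ((measurable_fderiv ℂ f).comp (hcont q₀).measurable).aestronglyMeasurable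
    exact ((isBoundedBilinearMap_comp (𝕜 := ℂ) (E := E) (F := E) (G := ℂ)).continuous
      ).comp_aestronglyMeasurable (h1.prodMk hL.aestronglyMeasurable)
  · refine Eventually.of_forall fun s hs q hq => ?_
    have hs' := uIoc_subset_uIcc hs
    rw [norm_smul]
    gcongr
    refine (ContinuousLinearMap.opNorm_comp_le _ _).trans ?_
    have h2 := norm_fderiv_le_of_bound_on_ball (f := f) (q := L s q + c s) (M := M)
      (half_pos hδ) (hf.mono fun y hy => hδU (hnear s hs' q hq y hy))
      (fun y hy => hM y (hnear s hs' q hq y hy))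
    exact mul_le_mul h2 (hB s hs') (norm_nonneg _) ((norm_nonneg _).trans h2)
  · exact hw.norm.mul_const _
  · refine Eventually.of_forall fun s hs q hq => ?_
    have hs' := uIoc_subset_uIcc hs
    exact ((hFd s hs' q hq).comp q ((L s).hasFDerivAt.add_const (c s))).const_mul (w s)

/-- Directional derivatives of holomorphic functions are holomorphic. -/
theorem differentiableOn_fderiv_apply {f : E → ℂ} {U : Set E} (hU : IsOpen U)
    (hf : DifferentiableOn ℂ f U) (v : E) : DifferentiableOn ℂ (fun q => fderiv ℂ f q v) U := by
  intro q₀ hq₀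
  obtain ⟨ε, hε, hεU⟩ := Metric.isOpen_iff.1 hU q₀ hq₀
  obtain ⟨r, hr, hrv⟩ : ∃ r > 0, r * ‖v‖ < ε / 2 := by
    refine ⟨ε / (4 * (‖v‖ + 1)), by positivity, ?_⟩
    rw [div_mul_eq_mul_div, div_lt_div_iff₀ (by positivity) (by positivity)]
    nlinarith [norm_nonneg v]
  have hmem : ∀ q ∈ ball q₀ (ε / 2), ∀ z : ℂ, ‖z‖ ≤ r → q + z • v ∈ U := by
    intro q hq z hz
    apply hεU
    rw [mem_ball, dist_eq_norm]
    have h1 : ‖z • v‖ < ε / 2 := by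
      rw [norm_smul]
      exact (mul_le_mul_of_nonneg_right hz (norm_nonneg _)).trans_lt hrv
    calc ‖q + z • v - q₀‖ = ‖(q - q₀) + z • v‖ := by congr 1; abel
      _ ≤ ‖q - q₀‖ + ‖z • v‖ := norm_add_le _ _
      _ < ε := by linarith [mem_ball_iff_norm.1 hq]
  have key : ∀ q ∈ ball q₀ (ε / 2), fderiv ℂ f q v = (2 * Real.pi * Complex.I)⁻¹ *
      ∫ s in (0 : ℝ)..2 * Real.pi, (deriv (circleMap 0 r) s * (1 / (circleMap 0 r s) ^ 2)) *
        f (ContinuousLinearMap.id ℂ E q + circleMap 0 r s • v) := by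
    intro q hq
    have hd : DifferentiableOn ℂ (fun z : ℂ => f (q + z • v)) (closedBall 0 r) := by
      intro z hz
      have h1 : DifferentiableAt ℂ f (q + z • v) := hf.differentiableAt
        (hU.mem_nhds (hmem q hq z (by simpa using hz)))
      exact (h1.comp z (f := fun z : ℂ => q + z • v) (by fun_prop)).differentiableWithinAt
    have h2 := hd.deriv_eq_smul_circleIntegral hr
    have h3 : deriv (fun z : ℂ => f (q + z • v)) 0 = fderiv ℂ f q v := by
      have h1 : HasFDerivAt f (fderiv ℂ f q) (q + (0 : ℂ) • v) := by
        have := hmem q hq 0 (by simpa using hr.le)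
        rw [zero_smul, add_zero] at this ⊢
        exact (hf.differentiableAt (hU.mem_nhds this)).hasFDerivAt
      have h4 : HasDerivAt (fun z : ℂ => q + z • v) v 0 := by
        simpa using ((hasDerivAt_id (0 : ℂ)).smul_const v).const_add q
      exact (h1.comp_hasDerivAt (0 : ℂ) h4).deriv
    rw [h3] at h2
    rw [eq_inv_mul_iff_mul_eq₀ (by simp [Real.pi_ne_zero]), ← smul_eq_mul, ← h2, circleIntegral]
    refine intervalIntegral.integral_congr fun s _ => ?_
    simp [mul_assoc]
  have hda : DifferentiableAt ℂ (fun q => (2 * Real.pi * Complex.I)⁻¹ *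
      ∫ s in (0 : ℝ)..2 * Real.pi, (deriv (circleMap 0 r) s * (1 / (circleMap 0 r s) ^ 2)) *
        f (ContinuousLinearMap.id ℂ E q + circleMap 0 r s • v)) q₀ := by
    refine DifferentiableAt.const_mul ?_ _
    refine differentiableAt_integral_comp_affine (L := fun _ => ContinuousLinearMap.id ℂ E)
      (c := fun s => circleMap 0 r s • v) hU hf ?_ continuous_const
      ((continuous_circleMap 0 r).smul continuous_const) ?_
    · apply Continuous.intervalIntegrable
      simp only [deriv_circleMap]
      refine ((continuous_circleMap 0 r).mul continuous_const).mul
        (continuous_const.div ((continuous_circleMap 0 r).pow 2) fun s => ?_)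
      exact pow_ne_zero 2 (circleMap_ne_center hr.ne')
    · intro s _
      exact hmem q₀ (mem_ball_self (by positivity)) _ (by simp [abs_of_pos hr])
  refine (hda.congr_of_eventuallyEq ?_).differentiableWithinAt
  filter_upwards [ball_mem_nhds q₀ (half_pos hε)] with q hq using key q hq

end Holomorphic

section Series

variable {E : Type*} [NormedAddCommGroup E] [NormedSpace ℂ E]

/-- Termwise differentiation of a locally normally convergent series of holomorphic functions. -/
theorem hasFDerivAt_tsum_of_locally_bounded {w : ℕ → E → ℂ} {q : E} {ε : ℝ} (hε : 0 < ε)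
    (hw : ∀ k, DifferentiableOn ℂ (w k) (ball q ε)) {c : ℕ → ℝ} (hc : Summable c)
    (hb : ∀ k, ∀ y ∈ ball q ε, ‖w k y‖ ≤ c k) :
    (∀ k, ∀ y ∈ ball q (ε / 2), ‖fderiv ℂ (w k) y‖ ≤ (c k + c k) / (ε / 2)) ∧
      HasFDerivAt (fun y => ∑' k, w k y) (∑' k, fderiv ℂ (w k) q) q := by
  have hsub : ∀ y ∈ ball q (ε / 2), ball y (ε / 2) ⊆ ball q ε := by
    intro y hy
    apply ball_subset_ball'
    linarith [mem_ball.1 hy]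
  have h1 : ∀ k, ∀ y ∈ ball q (ε / 2), ‖fderiv ℂ (w k) y‖ ≤ (c k + c k) / (ε / 2) :=
    fun k y hy => norm_fderiv_le_of_bound_on_ball (half_pos hε) ((hw k).mono (hsub y hy))
      fun z hz => hb k z (hsub y hy hz)
  refine ⟨h1, ?_⟩
  let _ : NormedSpace ℝ E := NormedSpace.restrictScalars ℝ ℂ E
  exact hasFDerivAt_tsum_of_isPreconnected (𝕜 := ℂ) (((hc.add hc).div_const (ε / 2))) isOpen_ball
    (convex_ball q (ε / 2)).isPreconnected
    (fun k y hy => ((hw k).differentiableAt (isOpen_ball.mem_nhds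
      (ball_subset_ball (by linarith) hy))).hasFDerivAt) h1 (mem_ball_self (half_pos hε))
    (Summable.of_norm_bounded hc fun k => hb k q (mem_ball_self hε)) (mem_ball_self (half_pos hε))

end Series

section Operators

variable {n : ℕ}

/-- Joint holomorphy on `ω × Ω`. -/
def HolOn (ω : Set ℂ) (Ω : Set (Fin n → ℂ)) (u : ℂ → (Fin n → ℂ) → ℂ) : Prop :=
  DifferentiableOn ℂ (fun q : ℂ × (Fin n → ℂ) => u q.1 q.2) (ω ×ˢ Ω)

/-- Locally normal summability of a series on `ω × Ω`. -/
def NormalOn (ω : Set ℂ) (Ω : Set (Fin n → ℂ)) (w : ℕ → ℂ → (Fin n → ℂ) → ℂ) : Prop :=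
  ∀ q ∈ ω ×ˢ Ω, ∃ ε > 0, ∃ c : ℕ → ℝ, Summable c ∧ ∀ k, ∀ y ∈ ball q ε, ‖w k y.1 y.2‖ ≤ c k

theorem NormalOn.summable {ω : Set ℂ} {Ω : Set (Fin n → ℂ)} {w : ℕ → ℂ → (Fin n → ℂ) → ℂ}
    (h : NormalOn ω Ω w) {t : ℂ} (ht : t ∈ ω) {x : Fin n → ℂ} (hx : x ∈ Ω) :
    Summable fun k => w k t x := by
  obtain ⟨ε, hε, c, hc, hb⟩ := h (t, x) ⟨ht, hx⟩
  exact Summable.of_norm_bounded hc fun k => hb k (t, x) (mem_ball_self hε)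

theorem HolOn.tsum {ω : Set ℂ} {Ω : Set (Fin n → ℂ)} (hω : IsOpen ω) (hΩ : IsOpen Ω)
    {w : ℕ → ℂ → (Fin n → ℂ) → ℂ} (hw : ∀ k, HolOn ω Ω (w k)) (h : NormalOn ω Ω w) :
    HolOn ω Ω fun t x => ∑' k, w k t x := by
  intro q hq
  obtain ⟨ε, hε, c, hc, hb⟩ := h q hq
  obtain ⟨δ, hδ, hδU⟩ := Metric.isOpen_iff.1 (hω.prod hΩ) q hq
  refine (hasFDerivAt_tsum_of_locally_bounded (w := fun k y => w k y.1 y.2) (lt_min hε hδ)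
    (fun k => (hw k).mono ((ball_subset_ball (min_le_right _ _)).trans hδU)) hc
    fun k y hy => hb k y (ball_subset_ball (min_le_left _ _) hy)).2.differentiableAt
    |>.differentiableWithinAt

theorem HolOn.congr {ω : Set ℂ} {Ω : Set (Fin n → ℂ)} {u v : ℂ → (Fin n → ℂ) → ℂ}
    (hu : HolOn ω Ω u) (h : ∀ t ∈ ω, ∀ x ∈ Ω, v t x = u t x) : HolOn ω Ω v :=
  DifferentiableOn.congr hu fun q hq => h q.1 hq.1 q.2 hq.2

theorem HolOn.add {ω : Set ℂ} {Ω : Set (Fin n → ℂ)} {u v : ℂ → (Fin n → ℂ) → ℂ}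
    (hu : HolOn ω Ω u) (hv : HolOn ω Ω v) : HolOn ω Ω fun t x => u t x + v t x :=
  DifferentiableOn.add hu hv

theorem HolOn.mul {ω : Set ℂ} {Ω : Set (Fin n → ℂ)} {u v : ℂ → (Fin n → ℂ) → ℂ}
    (hu : HolOn ω Ω u) (hv : HolOn ω Ω v) : HolOn ω Ω fun t x => u t x * v t x :=
  DifferentiableOn.mul hu hv

theorem HolOn.const_mul {ω : Set ℂ} {Ω : Set (Fin n → ℂ)} {u : ℂ → (Fin n → ℂ) → ℂ}
    (hu : HolOn ω Ω u) (c : ℂ) : HolOn ω Ω fun t x => c * u t x :=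
  DifferentiableOn.const_mul hu c

theorem HolOn.sum {ω : Set ℂ} {Ω : Set (Fin n → ℂ)} {ι : Type*} {s : Finset ι}
    {u : ι → ℂ → (Fin n → ℂ) → ℂ} (hu : ∀ i ∈ s, HolOn ω Ω (u i)) :
    HolOn ω Ω fun t x => ∑ i ∈ s, u i t x :=
  DifferentiableOn.fun_sum hu

theorem HolOn.of_fst {ω : Set ℂ} {Ω : Set (Fin n → ℂ)} {c : ℂ → ℂ} (hc : Differentiable ℂ c) :
    HolOn ω Ω fun t _ => c t :=
  (hc.comp differentiable_fst).differentiableOn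

theorem HolOn.mono {ω ω' : Set ℂ} {Ω Ω' : Set (Fin n → ℂ)} {u : ℂ → (Fin n → ℂ) → ℂ}
    (hu : HolOn ω Ω u) (h : ω' ⊆ ω) (h' : Ω' ⊆ Ω) : HolOn ω' Ω' u :=
  DifferentiableOn.mono hu (prod_mono h h')

/-- The formal properties of differential operators used below: they act linearly on holomorphic
functions, commute with locally normally convergent series, and do not lower the order of
vanishing at `t = 0`. -/
structure IsTameOp (ω : Set ℂ) (Ω : Set (Fin n → ℂ))
    (D : (ℂ → (Fin n → ℂ) → ℂ) → ℂ → (Fin n → ℂ) → ℂ) : Prop where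
  hol : ∀ u, HolOn ω Ω u → HolOn ω Ω (D u)
  congr : ∀ u v, HolOn ω Ω u → (∀ t ∈ ω, ∀ x ∈ Ω, v t x = u t x) →
    ∀ t ∈ ω, ∀ x ∈ Ω, D v t x = D u t x
  lin : ∀ u v, HolOn ω Ω u → HolOn ω Ω v → ∀ c : ℂ, ∀ t ∈ ω, ∀ x ∈ Ω,
    D (fun t x => c * u t x + v t x) t x = c * D u t x + D v t x
  series : ∀ w : ℕ → ℂ → (Fin n → ℂ) → ℂ, (∀ k, HolOn ω Ω (w k)) → NormalOn ω Ω w →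
    NormalOn ω Ω (fun k => D (w k)) ∧
      ∀ t ∈ ω, ∀ x ∈ Ω, D (fun t x => ∑' k, w k t x) t x = ∑' k, D (w k) t x
  order : ∀ k : ℕ, ∀ h, HolOn ω Ω h → ∃ h', HolOn ω Ω h' ∧ ∀ t ∈ ω, ∀ x ∈ Ω,
    D (fun t x => t ^ k * h t x) t x = t ^ k * h' t x

namespace IsTameOp

variable {ω : Set ℂ} {Ω : Set (Fin n → ℂ)}
  {D D' : (ℂ → (Fin n → ℂ) → ℂ) → ℂ → (Fin n → ℂ) → ℂ}

protected theorem id : IsTameOp ω Ω id where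
  hol _ hu := hu
  congr _ _ _ h := h
  lin _ _ _ _ _ _ _ _ _ := rfl
  series _ _ h := ⟨h, fun _ _ _ _ => rfl⟩
  order _ h hh := ⟨h, hh, fun _ _ _ _ => rfl⟩

theorem comp (hω : IsOpen ω) (hΩ : IsOpen Ω) (hD : IsTameOp ω Ω D) (hD' : IsTameOp ω Ω D') :
    IsTameOp ω Ω (fun u => D (D' u)) where
  hol u hu := hD.hol _ (hD'.hol u hu)
  congr u v hu h := hD.congr _ _ (hD'.hol u hu) (hD'.congr u v hu h)
  lin u v hu hv c t ht x hx := by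
    rw [← hD.lin _ _ (hD'.hol u hu) (hD'.hol v hv) c t ht x hx]
    exact hD.congr _ _ (((hD'.hol u hu).const_mul c).add (hD'.hol v hv))
      (hD'.lin u v hu hv c) t ht x hx
  series w hw h := by
    obtain ⟨h1, h2⟩ := hD'.series w hw h
    obtain ⟨h3, h4⟩ := hD.series _ (fun k => hD'.hol _ (hw k)) h1
    refine ⟨h3, fun t ht x hx => ?_⟩
    rw [← h4 t ht x hx]
    exact hD.congr _ _ (HolOn.tsum hω hΩ (fun k => hD'.hol _ (hw k)) h1) h2 t ht x hx
  order k h hh := by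
    obtain ⟨h', hh', h1⟩ := hD'.order k h hh
    obtain ⟨h'', hh'', h2⟩ := hD.order k h' hh'
    refine ⟨h'', hh'', fun t ht x hx => ?_⟩
    rw [← h2 t ht x hx]
    exact hD.congr _ _ ((HolOn.of_fst (by fun_prop)).mul hh') h1 t ht x hx

theorem iterate (hω : IsOpen ω) (hΩ : IsOpen Ω) (hD : IsTameOp ω Ω D) (j : ℕ) :
    IsTameOp ω Ω D^[j] := by
  induction j with
  | zero => exact IsTameOp.id
  | succ j ih => exact (ih.comp hω hΩ hD :)

theorem of_fderiv (hω : IsOpen ω) (hΩ : IsOpen Ω) {c : ℂ → ℂ} (hc : Differentiable ℂ c)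
    (v : ℂ × (Fin n → ℂ)) {d : ℂ} (hd : ∀ t, c t * v.1 = d * t)
    (hD : ∀ u, HolOn ω Ω u → ∀ t ∈ ω, ∀ x ∈ Ω,
      D u t x = c t * fderiv ℂ (fun q : ℂ × (Fin n → ℂ) => u q.1 q.2) (t, x) v) :
    IsTameOp ω Ω D := by
  have hU : IsOpen (ω ×ˢ Ω) := hω.prod hΩ
  have hda : ∀ u, HolOn ω Ω u → ∀ t ∈ ω, ∀ x ∈ Ω,
      DifferentiableAt ℂ (fun q : ℂ × (Fin n → ℂ) => u q.1 q.2) (t, x) :=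
    fun u hu t ht x hx => DifferentiableOn.differentiableAt hu (hU.mem_nhds ⟨ht, hx⟩)
  have hder : ∀ u, HolOn ω Ω u → HolOn ω Ω
      fun t x => fderiv ℂ (fun q : ℂ × (Fin n → ℂ) => u q.1 q.2) (t, x) v :=
    fun u hu => differentiableOn_fderiv_apply hU hu v
  refine ⟨fun u hu => ?_, fun u u' hu h t ht x hx => ?_, fun u u' hu hu' a t ht x hx => ?_,
    fun w hw h => ⟨fun q hq => ?_, fun t ht x hx => ?_⟩, fun k h hh => ?_⟩
  · exact ((HolOn.of_fst hc).mul (hder u hu)).congr (hD u hu)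
  · rw [hD u hu t ht x hx, hD u' (hu.congr h) t ht x hx]
    congr 2
    apply Filter.EventuallyEq.fderiv_eq
    filter_upwards [hU.mem_nhds (⟨ht, hx⟩ : (t, x) ∈ ω ×ˢ Ω)] with q hq using h _ hq.1 _ hq.2
  · rw [hD u hu t ht x hx, hD u' hu' t ht x hx, hD _ ((hu.const_mul a).add hu') t ht x hx,
      fderiv_fun_add ((hda u hu t ht x hx).const_mul a) (hda u' hu' t ht x hx),
      fderiv_const_mul (hda u hu t ht x hx)]
    simp
    ring
  · obtain ⟨ε, hε, b, hb, hbw⟩ := h q hq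
    obtain ⟨δ, hδ, hδU⟩ := Metric.isOpen_iff.1 hU q hq
    have h1 := (hasFDerivAt_tsum_of_locally_bounded (w := fun k y => w k y.1 y.2) (lt_min hε hδ)
      (fun k => DifferentiableOn.mono (f := fun y : ℂ × (Fin n → ℂ) => w k y.1 y.2) (hw k) ((ball_subset_ball (min_le_right _ _)).trans hδU)) hb
      fun k y hy => hbw k y (ball_subset_ball (min_le_left _ _) hy)).1
    obtain ⟨r, hr, hrc⟩ : ∃ r > 0, ∀ y ∈ ball q r, ‖c y.1‖ ≤ ‖c q.1‖ + 1 := by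
      have : ContinuousAt (fun y : ℂ × (Fin n → ℂ) => ‖c y.1‖) q := by
        have := hc.continuous
        fun_prop
      obtain ⟨r, hr, h2⟩ := Metric.continuousAt_iff.1 this 1 one_pos
      refine ⟨r, hr, fun y hy => ?_⟩
      have := h2 (mem_ball.1 hy)
      rw [Real.dist_eq] at this
      linarith [(abs_lt.1 this).2]
    refine ⟨min r (min ε δ / 2), lt_min hr (half_pos (lt_min hε hδ)),
      fun k => (‖c q.1‖ + 1) * ((b k + b k) / (min ε δ / 2) * ‖v‖),
      (((hb.add hb).div_const _).mul_right _).mul_left _, fun k y hy => ?_⟩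
    have hy1 := ball_subset_ball (min_le_left _ _) hy
    have hy2 := ball_subset_ball (min_le_right _ _) hy
    have hyU : y ∈ ω ×ˢ Ω := hδU (ball_subset_ball
      ((half_le_self (lt_min hε hδ).le).trans (min_le_right _ _)) hy2)
    simp only
    rw [hD _ (hw k) _ hyU.1 _ hyU.2, norm_mul]
    refine mul_le_mul (hrc y hy1) ?_ (norm_nonneg _) (by positivity)
    exact (ContinuousLinearMap.le_opNorm _ _).trans
      (mul_le_mul_of_nonneg_right (h1 k y hy2) (norm_nonneg _))
  · obtain ⟨ε, hε, b, hb, hbw⟩ := h (t, x) ⟨ht, hx⟩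
    obtain ⟨δ, hδ, hδU⟩ := Metric.isOpen_iff.1 hU (t, x) ⟨ht, hx⟩
    obtain ⟨h1, h2⟩ := hasFDerivAt_tsum_of_locally_bounded (w := fun k y => w k y.1 y.2)
      (lt_min hε hδ)
      (fun k => DifferentiableOn.mono (f := fun y : ℂ × (Fin n → ℂ) => w k y.1 y.2) (hw k) ((ball_subset_ball (min_le_right _ _)).trans hδU)) hb
      fun k y hy => hbw k y (ball_subset_ball (min_le_left _ _) hy)
    rw [hD _ (HolOn.tsum hω hΩ hw h) t ht x hx, h2.fderiv]
    have h3 : Summable fun k => fderiv ℂ (fun y : ℂ × (Fin n → ℂ) => w k y.1 y.2) (t, x) :=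
      Summable.of_norm_bounded ((hb.add hb).div_const (min ε δ / 2))
        fun k => h1 k (t, x) (mem_ball_self (half_pos (lt_min hε hδ)))
    have h4 := (ContinuousLinearMap.apply ℂ ℂ v).map_tsum h3
    simp only [ContinuousLinearMap.apply_apply] at h4
    rw [h4, ← tsum_mul_left]
    exact tsum_congr fun k => (hD _ (hw k) t ht x hx).symm
  · refine ⟨fun t x => k * d * h t x + c t *
      fderiv ℂ (fun q : ℂ × (Fin n → ℂ) => h q.1 q.2) (t, x) v,
      (hh.const_mul _).add ((HolOn.of_fst hc).mul (hder h hh)), fun t ht x hx => ?_⟩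
    rw [hD _ ((HolOn.of_fst (by fun_prop)).mul hh) t ht x hx]
    have h1 : HasFDerivAt (fun q : ℂ × (Fin n → ℂ) => q.1 ^ k)
        ((k * t ^ (k - 1)) • ContinuousLinearMap.fst ℂ ℂ (Fin n → ℂ)) (t, x) := by
      have := (hasFDerivAt_fst (𝕜 := ℂ) (p := (t, x))).pow k
      simpa [nsmul_eq_mul] using this
    rw [(h1.fun_mul (hda h hh t ht x hx).hasFDerivAt).fderiv]
    simp only [add_apply, smul_apply, smul_eq_mul,
      ContinuousLinearMap.coe_fst']
    have h2 : (k : ℂ) * t ^ (k - 1) * t = k * t ^ k := by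
      cases k with
      | zero => simp
      | succ k => simp [pow_succ]; ring
    linear_combination h t x * k * t ^ (k - 1) * hd t + d * h t x * h2

end IsTameOp

theorem isTameOp_thetaT {ω : Set ℂ} {Ω : Set (Fin n → ℂ)} (hω : IsOpen ω) (hΩ : IsOpen Ω) :
    IsTameOp ω Ω (thetaT (n := n)) := by
  refine IsTameOp.of_fderiv hω hΩ (c := fun t => t) differentiable_id (1, 0) (d := 1)
    (by simp) fun u hu t ht x hx => ?_
  have h1 := (DifferentiableOn.differentiableAt hu ((hω.prod hΩ).mem_nhds
    (⟨ht, hx⟩ : (t, x) ∈ ω ×ˢ Ω))).hasFDerivAt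
  have h2 : HasDerivAt (fun τ : ℂ => (τ, x)) (1, 0) t :=
    (hasDerivAt_id t).prodMk (hasDerivAt_const t x)
  have h3 := (h1.comp_hasDerivAt t h2).deriv
  exact congrArg (t * ·) h3

theorem isTameOp_partialX {ω : Set ℂ} {Ω : Set (Fin n → ℂ)} (hω : IsOpen ω) (hΩ : IsOpen Ω)
    (k : Fin n) : IsTameOp ω Ω (partialX k) := by
  refine IsTameOp.of_fderiv hω hΩ (c := fun _ => 1) (differentiable_const _) (0, Pi.single k 1)
    (d := 0) (by simp) fun u hu t ht x hx => ?_
  have h1 := (DifferentiableOn.differentiableAt hu ((hω.prod hΩ).mem_nhds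
    (⟨ht, hx⟩ : (t, x) ∈ ω ×ˢ Ω))).hasFDerivAt
  have h2 : HasDerivAt (fun z : ℂ => (t, Function.update x k z)) (0, Pi.single k 1) (x k) :=
    (hasDerivAt_const _ t).prodMk (hasDerivAt_update x k (x k))
  rw [partialX, one_mul]
  have h3 : HasFDerivAt (fun q : ℂ × (Fin n → ℂ) => u q.1 q.2)
      (fderiv ℂ (fun q : ℂ × (Fin n → ℂ) => u q.1 q.2) (t, x))
      (t, Function.update x k (x k)) := by rwa [Function.update_eq_self]
  have h4 := (h3.comp_hasDerivAt (x k) h2).deriv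
  exact h4

theorem isTameOp_partialPow {ω : Set ℂ} {Ω : Set (Fin n → ℂ)} (hω : IsOpen ω) (hΩ : IsOpen Ω)
    (α : Fin n → ℕ) : IsTameOp ω Ω (partialPow α) := by
  unfold partialPow
  induction List.finRange n with
  | nil => exact IsTameOp.id
  | cons k l ih => exact ((isTameOp_partialX hω hΩ k).iterate hω hΩ (α k)).comp hω hΩ ih

end Operators

section Indicial

variable {n : ℕ}

theorem thetaT_pow_mul {ω : Set ℂ} {Ω : Set (Fin n → ℂ)} (hω : IsOpen ω) (hΩ : IsOpen Ω)
    {h : ℂ → (Fin n → ℂ) → ℂ} (hh : HolOn ω Ω h) (k : ℕ) {t : ℂ} (ht : t ∈ ω)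
    {x : Fin n → ℂ} (hx : x ∈ Ω) :
    thetaT (fun t x => t ^ k * h t x) t x = t ^ k * (k * h t x + thetaT h t x) := by
  have h1 : DifferentiableAt ℂ (fun τ => h τ x) t :=
    (DifferentiableOn.differentiableAt hh ((hω.prod hΩ).mem_nhds
      (⟨ht, hx⟩ : (t, x) ∈ ω ×ˢ Ω))).comp t (f := fun τ => (τ, x)) (by fun_prop)
  have h2 := ((hasDerivAt_pow k t).fun_mul h1.hasDerivAt).deriv
  simp only [thetaT]
  rw [h2]
  cases k with
  | zero => simp
  | succ k => simp [pow_succ]; ring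

/-- For `re μ < 0`, the integral `∫₀¹ σ^(-μ-1) g(σt,x) dσ` solves `θ_t h = μ h + g`. -/
theorem thetaT_integral {ω : Set ℂ} {Ω : Set (Fin n → ℂ)} (hω : IsOpen ω) (hΩ : IsOpen Ω)
    (hstar : ∀ t ∈ ω, ∀ σ : ℝ, 0 ≤ σ → σ ≤ 1 → (σ : ℂ) * t ∈ ω) {μ : ℂ} (hμ : μ.re < 0)
    {g : ℂ → (Fin n → ℂ) → ℂ} (hg : HolOn ω Ω g) :
    HolOn ω Ω (fun t x => ∫ σ in (0 : ℝ)..1, (σ : ℂ) ^ (-μ - 1) * g (σ * t) x) ∧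
      ∀ t ∈ ω, ∀ x ∈ Ω,
        thetaT (fun t x => ∫ σ in (0 : ℝ)..1, (σ : ℂ) ^ (-μ - 1) * g (σ * t) x) t x =
          μ * (∫ σ in (0 : ℝ)..1, (σ : ℂ) ^ (-μ - 1) * g (σ * t) x) + g t x := by
  have hwt : ∀ a b : ℝ, IntervalIntegrable (fun σ : ℝ => (σ : ℂ) ^ (-μ - 1)) volume a b :=
    fun a b => intervalIntegral.intervalIntegrable_cpow' (by simp; linarith)
  set H : ℂ → (Fin n → ℂ) → ℂ :=
    fun t x => ∫ σ in (0 : ℝ)..1, (σ : ℂ) ^ (-μ - 1) * g (σ * t) x with hH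
  have hHol : HolOn ω Ω H := by
    intro q hq
    have := differentiableAt_integral_comp_affine (f := fun q : ℂ × (Fin n → ℂ) => g q.1 q.2)
      (hω.prod hΩ) hg (hwt 0 1)
      (L := fun σ : ℝ => (σ : ℂ) • (ContinuousLinearMap.inl ℂ ℂ (Fin n → ℂ)).comp
          (ContinuousLinearMap.fst ℂ ℂ (Fin n → ℂ)) +
        (ContinuousLinearMap.inr ℂ ℂ (Fin n → ℂ)).comp
          (ContinuousLinearMap.snd ℂ ℂ (Fin n → ℂ)))
      (by fun_prop) (c := fun _ => 0) continuous_const (q₀ := q) (by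
        intro s hs
        rw [uIcc_of_le zero_le_one] at hs
        simpa using ⟨hstar q.1 hq.1 s hs.1 hs.2, hq.2⟩)
    refine DifferentiableAt.differentiableWithinAt ?_
    simpa using this
  refine ⟨hHol, fun t ht x hx => ?_⟩
  have hgd : ∀ t ∈ ω, ContinuousAt (fun τ => g τ x) t := fun t ht =>
    ((DifferentiableOn.continuousOn hg).continuousAt ((hω.prod hΩ).mem_nhds
      (⟨ht, hx⟩ : (t, x) ∈ ω ×ˢ Ω))).comp (f := fun τ => (τ, x)) (by fun_prop)
  set F : ℝ → ℂ := fun ρ => (ρ : ℂ) ^ (-μ - 1) * g (ρ * t) x with hF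
  have hFint : IntervalIntegrable F volume 0 1 := by
    refine (hwt 0 1).mul_continuousOn ?_
    intro s hs
    rw [uIcc_of_le zero_le_one] at hs
    exact ((hgd _ (hstar t ht s hs.1 hs.2)).comp (f := fun s : ℝ => (s : ℂ) * t)
      (by fun_prop)).continuousWithinAt
  have hnear : ∀ᶠ s : ℝ in 𝓝 1, 0 < s ∧ (s : ℂ) * t ∈ ω := by
    refine (eventually_gt_nhds one_pos).and ?_
    have : ContinuousAt (fun s : ℝ => (s : ℂ) * t) 1 := by fun_prop
    exact this.eventually_mem (hω.mem_nhds (by simpa using ht))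
  have hFc : ∀ᶠ s : ℝ in 𝓝 1, ContinuousAt F s := by
    filter_upwards [hnear] with s hs
    refine ContinuousAt.mul ?_ ?_
    · exact (Complex.continuousAt_ofReal_cpow_const s _ (Or.inr hs.1.ne'))
    · exact (hgd _ hs.2).comp (f := fun s : ℝ => (s : ℂ) * t) (by fun_prop)
  have hFTC : HasDerivAt (fun s => ∫ ρ in (0 : ℝ)..s, F ρ) (F 1) 1 := by
    obtain ⟨S, hS, hSo, h1S⟩ := _root_.eventually_nhds_iff.1 hFc
    refine intervalIntegral.integral_hasDerivAt_right hFint ?_ hFc.self_of_nhds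
    exact ContinuousOn.stronglyMeasurableAtFilter hSo
      (fun s hs => (hS s hs).continuousWithinAt) 1 h1S
  have hpow : HasDerivAt (fun s : ℝ => (s : ℂ) ^ μ) μ 1 := by
    have h0 : μ ≠ 0 := fun h => by simp [h] at hμ
    have := hasDerivAt_ofReal_cpow_const' (x := 1) one_ne_zero (r := μ - 1)
      (by intro h; apply h0; linear_combination h)
    have h2 := this.const_mul μ
    simp only [Complex.ofReal_one, Complex.one_cpow, mul_one, sub_add_cancel] at h2
    refine h2.congr_of_eventuallyEq (Eventually.of_forall fun s => ?_)
    simp only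
    field_simp
  have hprod := hpow.mul hFTC
  have hHd : HasDerivAt (fun τ => H τ x) (deriv (fun τ => H τ x) t) t := by
    refine DifferentiableAt.hasDerivAt ?_
    exact (DifferentiableOn.differentiableAt hHol ((hω.prod hΩ).mem_nhds
      (⟨ht, hx⟩ : (t, x) ∈ ω ×ˢ Ω))).comp t (f := fun τ => (τ, x)) (by fun_prop)
  have hHs : HasDerivAt (fun s : ℝ => H (s * t) x) (deriv (fun τ => H τ x) t * t) 1 := by
    have h1 : HasDerivAt (fun s : ℝ => (s : ℂ) * t) t 1 := by
      simpa using (Complex.ofRealCLM.hasDerivAt (x := 1)).mul_const t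
    have h2 : HasDerivAt (fun τ => H τ x) (deriv (fun τ => H τ x) t) (((1 : ℝ) : ℂ) * t) := by
      simpa using hHd
    exact h2.comp 1 h1
  have heq : (fun s : ℝ => H (s * t) x) =ᶠ[𝓝 1]
      (fun s : ℝ => (s : ℂ) ^ μ) * fun s => ∫ ρ in (0 : ℝ)..s, F ρ := by
    filter_upwards [hnear] with s hs
    have hs0 : (s : ℂ) ≠ 0 := by exact_mod_cast hs.1.ne'
    have h1 := intervalIntegral.integral_comp_mul_left (a := 0) (b := 1) F hs.1.ne'
    rw [mul_zero, mul_one] at h1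
    have h2 : ∫ σ in (0 : ℝ)..1, F (s * σ) = (s : ℂ) ^ (-μ - 1) * H (s * t) x := by
      rw [hH, ← intervalIntegral.integral_const_mul]
      refine intervalIntegral.integral_congr fun σ hσ => ?_
      rw [uIcc_of_le zero_le_one] at hσ
      simp only [hF]
      rw [Complex.ofReal_mul, Complex.mul_cpow_ofReal_nonneg hs.1.le hσ.1,
        show (s : ℂ) * σ * t = σ * (s * t) by ring]
      ring
    rw [h2] at h1
    have h3 : (s : ℂ) ^ (-μ - 1) = ((s : ℂ) ^ μ)⁻¹ * (s : ℂ)⁻¹ := by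
      rw [Complex.cpow_sub _ _ hs0, Complex.cpow_neg, Complex.cpow_one, div_eq_mul_inv]
    have h4 : (s : ℂ) ^ μ ≠ 0 := by simp [Complex.cpow_eq_zero_iff, hs0]
    rw [h3, Complex.real_smul, Complex.ofReal_inv] at h1
    simp only [Pi.mul_apply]
    field_simp at h1
    exact h1
  have hfin := hHs.unique (hprod.congr_of_eventuallyEq heq)
  simp only [thetaT]
  rw [mul_comm t, hfin]
  simp [hF]

theorem exists_thetaT_eq {ω : Set ℂ} {Ω : Set (Fin n → ℂ)} (hω : IsOpen ω) (hΩ : IsOpen Ω)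
    (hstar : ∀ t ∈ ω, ∀ σ : ℝ, 0 ≤ σ → σ ≤ 1 → (σ : ℂ) * t ∈ ω) (N : ℕ) {μ : ℂ}
    (hμ : μ.re < N) (hμN : ∀ k : ℕ, μ ≠ k)
    {g : ℂ → (Fin n → ℂ) → ℂ} (hg : HolOn ω Ω g) :
    ∃ h, HolOn ω Ω h ∧ ∀ t ∈ ω, ∀ x ∈ Ω, thetaT h t x = μ * h t x + g t x := by
  induction N generalizing μ g with
  | zero => exact ⟨_, thetaT_integral hω hΩ hstar (by simpa using hμ) hg⟩
  | succ N ih =>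
    have hderiv : ∀ u, HolOn ω Ω u → ∀ t ∈ ω, ∀ x ∈ Ω, DifferentiableAt ℂ (fun τ => u τ x) t :=
      fun u hu t ht x hx => (DifferentiableOn.differentiableAt hu ((hω.prod hΩ).mem_nhds
        (⟨ht, hx⟩ : (t, x) ∈ ω ×ˢ Ω))).comp t (f := fun τ => (τ, x)) (by fun_prop)
    have hg' : HolOn ω Ω fun t x => deriv (fun τ => g τ x) t := by
      refine HolOn.congr (u := fun t x =>
        fderiv ℂ (fun q : ℂ × (Fin n → ℂ) => g q.1 q.2) (t, x) (1, 0))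
        (differentiableOn_fderiv_apply (hω.prod hΩ) hg (1, 0)) fun t ht x hx => ?_
      have h1 := (DifferentiableOn.differentiableAt hg ((hω.prod hΩ).mem_nhds
        (⟨ht, hx⟩ : (t, x) ∈ ω ×ˢ Ω))).hasFDerivAt
      have h2 : HasDerivAt (fun τ : ℂ => (τ, x)) (1, 0) t :=
        (hasDerivAt_id t).prodMk (hasDerivAt_const t x)
      have h3 := (h1.comp_hasDerivAt t h2).deriv
      exact h3
    obtain ⟨H, hH, hHeq⟩ := ih (μ := μ - 1) (by push_cast at hμ; simp; linarith)
      (fun k hk => hμN (k + 1) (by push_cast; linear_combination hk)) hg'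
    have hμ0 : μ ≠ 0 := by simpa using hμN 0
    refine ⟨fun t x => μ⁻¹ * (t * H t x + -1 * g t x),
      (((HolOn.of_fst differentiable_id).mul hH).add (hg.const_mul (-1))).const_mul _,
      fun t ht x hx => ?_⟩
    have h1 := hHeq t ht x hx
    have h2 := ((((hasDerivAt_id t).fun_mul (hderiv H hH t ht x hx).hasDerivAt).fun_add
      ((hderiv g hg t ht x hx).hasDerivAt.const_mul (-1))).const_mul μ⁻¹).deriv
    simp only [thetaT, id] at h1 h2 ⊢
    rw [h2]
    field_simp
    linear_combination t * h1

theorem exists_thetaT_pow_mul_eq {ω : Set ℂ} {Ω : Set (Fin n → ℂ)} (hω : IsOpen ω)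
    (hΩ : IsOpen Ω) (hstar : ∀ t ∈ ω, ∀ σ : ℝ, 0 ≤ σ → σ ≤ 1 → (σ : ℂ) * t ∈ ω) {l : ℂ}
    (hl : ∀ k : ℕ, l ≠ k) (k : ℕ) {g : ℂ → (Fin n → ℂ) → ℂ} (hg : HolOn ω Ω g) :
    ∃ h, HolOn ω Ω h ∧
      (∀ t ∈ ω, ∀ x ∈ Ω, thetaT (fun t x => t ^ k * h t x) t x =
        l * (t ^ k * h t x) + t ^ k * g t x) ∧
      (1 ≤ k → l.re < k → ∀ t ∈ ω, ∀ x ∈ Ω, ∀ M : ℝ,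
        (∀ σ ∈ Ioc (0 : ℝ) 1, ‖((σ : ℂ) * t) ^ k * g (σ * t) x‖ ≤ M * ‖(σ : ℂ) * t‖ ^ k) →
        ‖t ^ k * h t x‖ ≤ M * ‖t‖ ^ k / (k - l.re)) := by
  have hlift : ∀ h, HolOn ω Ω h → (∀ t ∈ ω, ∀ x ∈ Ω, thetaT h t x = (l - k) * h t x + g t x) →
      ∀ t ∈ ω, ∀ x ∈ Ω, thetaT (fun t x => t ^ k * h t x) t x =
        l * (t ^ k * h t x) + t ^ k * g t x := by
    intro h hh heq t ht x hx
    rw [thetaT_pow_mul hω hΩ hh k ht hx, heq t ht x hx]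
    ring
  by_cases hk : l.re < k
  · obtain ⟨h1, h2⟩ := thetaT_integral hω hΩ hstar (μ := l - k) (by simpa using hk) hg
    refine ⟨_, h1, hlift _ h1 h2, fun hk1 _ t ht x hx M hM => ?_⟩
    rcases eq_or_ne t 0 with rfl | ht0
    · simp [zero_pow (by omega : k ≠ 0)]
    have htn : 0 < ‖t‖ := norm_pos_iff.2 ht0
    have hgM : ∀ σ ∈ Ioc (0 : ℝ) 1, ‖g (σ * t) x‖ ≤ M := by
      intro σ hσ
      have h3 := hM σ hσ
      rw [norm_mul, norm_pow, mul_comm M] at h3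
      refine le_of_mul_le_mul_left h3 (pow_pos (norm_pos_iff.2 ?_) k)
      exact mul_ne_zero (by exact_mod_cast hσ.1.ne') ht0
    rw [norm_mul, norm_pow, mul_comm M, mul_div_assoc]
    refine mul_le_mul_of_nonneg_left ?_ (by positivity)
    have hr : -1 < (k : ℝ) - l.re - 1 := by linarith
    have hintegrable : IntervalIntegrable (fun σ : ℝ => σ ^ ((k : ℝ) - l.re - 1) * M) volume 0 1 :=
      (intervalIntegral.intervalIntegrable_rpow' hr).mul_const M
    refine (intervalIntegral.norm_integral_le_of_norm_le zero_le_one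
      (Eventually.of_forall fun σ hσ => ?_) hintegrable).trans_eq ?_
    · rw [norm_mul, Complex.norm_cpow_eq_rpow_re_of_pos hσ.1]
      refine mul_le_mul (le_of_eq ?_) (hgM σ hσ) (norm_nonneg _) (Real.rpow_nonneg hσ.1.le _)
      congr 1
      simp
    · rw [intervalIntegral.integral_mul_const, integral_rpow (Or.inl hr)]
      rw [Real.one_rpow, Real.zero_rpow (by linarith)]
      simp only [sub_zero, sub_add_cancel]
      ring
  · obtain ⟨N, hN⟩ := exists_nat_gt (l - k).re
    obtain ⟨h, hh, heq⟩ := exists_thetaT_eq hω hΩ hstar N hN (fun j hj => hl (j + k)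
      (by push_cast; linear_combination hj)) hg
    exact ⟨h, hh, hlift h hh heq, fun _ h1 => absurd h1 hk⟩

theorem sum_coeff_X_sub_C_mul (q : ℂ[X]) (l : ℂ) (a b : ℕ → ℂ)
    (hab : ∀ j, b (j + 1) = l * b j + a j) :
    ∑ j ∈ Finset.range (((X - C l) * q).natDegree + 1), ((X - C l) * q).coeff j * b j =
      ∑ j ∈ Finset.range (q.natDegree + 1), q.coeff j * a j := by
  have key : ∀ c : ℕ → ℂ, ∃ φ : ℂ[X] →ₗ[ℂ] ℂ, (∀ r : ℂ[X],
      φ r = ∑ j ∈ Finset.range (r.natDegree + 1), r.coeff j * c j) ∧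
      ∀ j z, φ (monomial j z) = z * c j := by
    intro c
    refine ⟨Polynomial.lsum fun j => LinearMap.mulRight ℂ (c j), fun r => ?_, fun j z => ?_⟩
    · rw [Polynomial.lsum_apply, Polynomial.sum_over_range _ (by simp)]
      simp
    · rw [Polynomial.lsum_apply, Polynomial.sum_monomial_index _ _ (by simp)]
      simp
  obtain ⟨φ, hφ, hφm⟩ := key a
  obtain ⟨ψ, hψ, hψm⟩ := key b
  rw [← hφ, ← hψ]
  have : ψ ∘ₗ LinearMap.mulLeft ℂ (X - C l) = φ := by
    refine Polynomial.lhom_ext' fun j => LinearMap.ext_ring ?_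
    simp only [LinearMap.comp_apply, LinearMap.mulLeft_apply, sub_mul, X_mul_monomial,
      C_mul_monomial, map_sub, hφm, hψm, hab]
    ring
  rw [← this]
  rfl

/-- Inversion of `p(θ_t)` on functions vanishing to order `k` at `t = 0`, with gain of `m`
powers of `k`. -/
theorem exists_indicial_inverse (m : ℕ) (p : ℂ[X]) (hmonic : p.Monic) (hdeg : p.natDegree = m)
    (hchar : ∀ k : ℕ, p.eval (k : ℂ) ≠ 0) :
    ∃ C : ℝ, 0 ≤ C ∧ ∃ k₀ : ℕ, 1 ≤ k₀ ∧ ∀ (ω : Set ℂ) (Ω : Set (Fin n → ℂ)), IsOpen ω → IsOpen Ω →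
      (∀ t ∈ ω, ∀ σ : ℝ, 0 ≤ σ → σ ≤ 1 → (σ : ℂ) * t ∈ ω) →
      ∀ (k : ℕ) (g : ℂ → (Fin n → ℂ) → ℂ), HolOn ω Ω g → ∃ h, HolOn ω Ω h ∧
        (∀ t ∈ ω, ∀ x ∈ Ω, ∑ j ∈ Finset.range (p.natDegree + 1),
          p.coeff j * (thetaT^[j] (fun t x => t ^ k * h t x)) t x = t ^ k * g t x) ∧
        (k₀ ≤ k → ∀ t ∈ ω, ∀ x ∈ Ω, ∀ M : ℝ,
          (∀ σ ∈ Ioc (0 : ℝ) 1, ‖((σ : ℂ) * t) ^ k * g (σ * t) x‖ ≤ M * ‖(σ : ℂ) * t‖ ^ k) →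
          ∀ i j, i + j ≤ m →
            (k : ℝ) ^ i * ‖(thetaT^[j] (fun t x => t ^ k * h t x)) t x‖ ≤
              C * (M * ‖t‖ ^ k)) := by
  induction m generalizing p with
  | zero =>
    obtain rfl := hmonic.natDegree_eq_zero.1 hdeg
    refine ⟨1, zero_le_one, 1, le_rfl, fun ω Ω hω hΩ hstar k g hg => ⟨g, hg, by simp, ?_⟩⟩
    intro _ t ht x hx M hM i j hij
    obtain ⟨rfl, rfl⟩ : i = 0 ∧ j = 0 := by omega
    simpa using hM 1 (by simp)
  | succ m ih =>
    obtain ⟨l, hlr⟩ := Complex.exists_root (f := p)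
      (natDegree_pos_iff_degree_pos.1 (by omega))
    obtain ⟨q, rfl⟩ := dvd_iff_isRoot.2 hlr
    have hqm : q.Monic := Monic.of_mul_monic_left (monic_X_sub_C l) hmonic
    have hqd : q.natDegree = m := by
      rw [Monic.natDegree_mul (monic_X_sub_C l) hqm, natDegree_X_sub_C] at hdeg
      omega
    have hl : ∀ k : ℕ, l ≠ k := by
      rintro k rfl
      exact hchar k (by simp)
    obtain ⟨C₁, hC0, k₀, hk₀, H⟩ := ih q hqm hqd fun k hk => hchar k (by simp [hk])
    obtain ⟨k₁, hk₁⟩ := exists_nat_ge (2 * ‖l‖)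
    refine ⟨2 * C₁ * (1 + ‖l‖) ^ (m + 1), by positivity, max k₀ k₁, le_max_of_le_left hk₀, ?_⟩
    intro ω Ω hω hΩ hstar k g hg
    obtain ⟨h₀, hh₀, heq₀, hb₀⟩ := H ω Ω hω hΩ hstar k g hg
    obtain ⟨h, hh, heq, hb⟩ := exists_thetaT_pow_mul_eq hω hΩ hstar hl k hh₀
    have hpk : ∀ u, HolOn ω Ω u → HolOn ω Ω fun t x => t ^ k * u t x := fun u hu =>
      (HolOn.of_fst (by fun_prop)).mul hu
    have hrec : ∀ j, ∀ t ∈ ω, ∀ x ∈ Ω, (thetaT^[j + 1] (fun t x => t ^ k * h t x)) t x =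
        l * (thetaT^[j] (fun t x => t ^ k * h t x)) t x +
          (thetaT^[j] (fun t x => t ^ k * h₀ t x)) t x := by
      intro j t ht x hx
      have hT := (isTameOp_thetaT hω hΩ).iterate hω hΩ j
      rw [← hT.lin _ _ (hpk h hh) (hpk h₀ hh₀) l t ht x hx, Function.iterate_succ_apply]
      exact hT.congr _ _ (((hpk h hh).const_mul l).add (hpk h₀ hh₀)) heq t ht x hx
    refine ⟨h, hh, fun t ht x hx => ?_, fun hk t ht x hx M hM => ?_⟩
    · rw [← heq₀ t ht x hx]
      exact sum_coeff_X_sub_C_mul q l _ _ fun j => hrec j t ht x hx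
    have hkk₀ := (le_max_left _ _).trans hk
    have hkk₁ : 2 * ‖l‖ ≤ k := hk₁.trans (by exact_mod_cast (le_max_right _ _).trans hk)
    have hk1 : 1 ≤ k := hk₀.trans hkk₀
    have hk1' : (1 : ℝ) ≤ k := by exact_mod_cast hk1
    have hre : l.re ≤ k / 2 := (Complex.re_le_norm l).trans (by linarith)
    have hb₁ := hb₀ hkk₀ t ht x hx M hM
    set Q := M * ‖t‖ ^ k with hQ
    have hQ0 : 0 ≤ Q := by
      have := (norm_nonneg _).trans (hM 1 (by simp))
      simpa using this
    have hzero : ∀ i, i ≤ m → (k : ℝ) ^ (i + 1) * ‖t ^ k * h t x‖ ≤ 2 * C₁ * Q := by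
      intro i hi
      have h1 := hb hk1 (by linarith) t ht x hx (C₁ * M / k ^ i) (fun σ hσ => by
        have h2 := hb₀ hkk₀ (σ * t) (hstar t ht σ hσ.1.le hσ.2) x hx M (fun σ' hσ' => by
          have h3 := hM (σ' * σ) ⟨mul_pos hσ'.1 hσ.1, mul_le_one₀ hσ'.2 hσ.1.le hσ.2⟩
          rw [← mul_assoc, ← Complex.ofReal_mul]
          exact h3) i 0 (by omega)
        rw [div_mul_eq_mul_div, le_div_iff₀ (by positivity), mul_comm]
        simpa [mul_assoc] using h2)
      have hden : (0 : ℝ) < k - l.re := by linarith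
      rw [le_div_iff₀ hden, div_mul_eq_mul_div, le_div_iff₀ (by positivity)] at h1
      have h4 : ‖t ^ k * h t x‖ * (k / 2) * k ^ i ≤ ‖t ^ k * h t x‖ * (k - l.re) * k ^ i := by
        gcongr
        linarith
      rw [pow_succ]
      have h5 : C₁ * M * ‖t‖ ^ k = C₁ * Q := by rw [hQ, mul_assoc]
      linarith
    have hmain : ∀ j i, i + j ≤ m + 1 →
        (k : ℝ) ^ i * ‖(thetaT^[j] (fun t x => t ^ k * h t x)) t x‖ ≤
          2 * C₁ * (1 + ‖l‖) ^ j * Q := by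
      intro j
      induction j with
      | zero =>
        intro i hi
        simp only [Function.iterate_zero, id, pow_zero, mul_one]
        rcases i with _ | i
        · refine le_trans ?_ (hzero 0 (Nat.zero_le _))
          exact mul_le_mul_of_nonneg_right (pow_le_pow_right₀ hk1' (by omega)) (norm_nonneg _)
        · exact hzero i (by omega)
      | succ j ihj =>
        intro i hi
        rw [hrec j t ht x hx]
        have h1 := ihj i (by omega)
        have h2 := hb₁ i j (by omega)
        have h3 : 1 ≤ (1 + ‖l‖) ^ j := one_le_pow₀ (by linarith [norm_nonneg l])
        calc _ ≤ (k : ℝ) ^ i * (‖l‖ * ‖(thetaT^[j] (fun t x => t ^ k * h t x)) t x‖ +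
              ‖(thetaT^[j] (fun t x => t ^ k * h₀ t x)) t x‖) := by
              gcongr
              exact (norm_add_le _ _).trans_eq (by rw [norm_mul])
          _ ≤ ‖l‖ * (2 * C₁ * (1 + ‖l‖) ^ j * Q) + C₁ * Q := by
              rw [mul_add, mul_left_comm]
              gcongr
          _ ≤ ‖l‖ * (2 * C₁ * (1 + ‖l‖) ^ j * Q) + C₁ * (2 * (1 + ‖l‖) ^ j) * Q := by
              gcongr
              nlinarith
          _ = _ := by ring
    intro i j hij
    refine (hmain j i hij).trans ?_
    gcongr
    · linarith [norm_nonneg l]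
    · omega

end Indicial

section Nagumo

variable {n : ℕ}

theorem norm_partialX_mul_pow_le {ω : Set ℂ} {Ω : Set (Fin n → ℂ)}
    {u : ℂ → (Fin n → ℂ) → ℂ} (hu : HolOn ω Ω u) {t : ℂ} (ht : t ∈ ω)
    {y : Fin n → ℂ} {r : ℝ} (hy : ball y r ⊆ Ω) {N : ℕ} {M : ℝ}
    (hM : ∀ x ∈ ball y r, ‖u t x‖ * (r - dist x y) ^ N ≤ M) (k : Fin n) :
    ∀ x ∈ ball y r, ‖partialX k u t x‖ * (r - dist x y) ^ (N + 1) ≤ M * (4 * (N + 1)) := by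
  intro x hx
  set d : ℝ := r - dist x y with hd
  have hd0 : 0 < d := by rw [mem_ball] at hx; linarith
  set R : ℝ := d / (2 * (N + 1)) with hR
  have hN : (0 : ℝ) < 2 * (N + 1) := by positivity
  have hR0 : 0 < R := by positivity
  have hRd : R < d := by
    rw [hR, div_lt_iff₀ hN]
    nlinarith [(Nat.cast_nonneg N : (0 : ℝ) ≤ N)]
  have hdist : ∀ z ∈ closedBall (x k) R, d - R ≤ r - dist (Function.update x k z) y := by
    intro z hz
    have h1 : dist (Function.update x k z) x ≤ R := by
      refine (dist_pi_le_iff hR0.le).2 fun i => ?_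
      rcases eq_or_ne i k with rfl | hi
      · simpa using hz
      · simp [hi, hR0.le]
    linarith [dist_triangle (Function.update x k z) x y]
  have hmem : ∀ z ∈ closedBall (x k) R, Function.update x k z ∈ ball y r := by
    intro z hz
    rw [mem_ball]
    linarith [hdist z hz]
  have hdiff : DifferentiableOn ℂ (fun z => u t (Function.update x k z)) (closedBall (x k) R) := by
    have hupd : Differentiable ℂ fun z => (t, Function.update x k z) :=
      (differentiable_const t).prodMk fun z => (hasDerivAt_update x k z).differentiableAt
    exact DifferentiableOn.comp (g := fun q : ℂ × (Fin n → ℂ) => u q.1 q.2) hu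
      hupd.differentiableOn fun z hz => ⟨ht, hy (hmem z hz)⟩
  have hbern : d ^ N ≤ 2 * (d - R) ^ N := by
    have h1 := one_add_mul_le_pow (a := -(1 / (2 * ((N : ℝ) + 1)))) (by
      rw [neg_le_neg_iff, div_le_iff₀ hN]
      nlinarith [(Nat.cast_nonneg N : (0 : ℝ) ≤ N)]) N
    have h2 : (1 : ℝ) / 2 ≤ 1 + N * -(1 / (2 * ((N : ℝ) + 1))) := by
      field_simp
      linarith
    have h3 : d - R = d * (1 + -(1 / (2 * ((N : ℝ) + 1)))) := by
      rw [hR]; ring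
    rw [h3, mul_pow]
    nlinarith [pow_pos hd0 N]
  have hdN : 0 < d ^ N := pow_pos hd0 N
  have hbound : ∀ z ∈ sphere (x k) R, ‖u t (Function.update x k z)‖ ≤ 2 * M / d ^ N := by
    intro z hz
    have hz' := sphere_subset_closedBall hz
    rw [le_div_iff₀ hdN]
    have h1 := hM _ (hmem z hz')
    have h2 : (d - R) ^ N ≤ (r - dist (Function.update x k z) y) ^ N :=
      pow_le_pow_left₀ (by linarith) (hdist z hz') N
    nlinarith [norm_nonneg (u t (Function.update x k z))]
  have h := Complex.norm_deriv_le_of_forall_mem_sphere_norm_le hR0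
    (hdiff.diffContOnCl_ball le_rfl) hbound
  calc ‖partialX k u t x‖ * d ^ (N + 1) ≤ 2 * M / d ^ N / R * d ^ (N + 1) := by
        gcongr
        exact h
    _ = M * (4 * (N + 1)) := by
        rw [hR, pow_succ]
        field_simp
        ring

theorem norm_partialX_iterate_mul_pow_le {ω : Set ℂ} {Ω : Set (Fin n → ℂ)} (hω : IsOpen ω)
    (hΩ : IsOpen Ω) {u : ℂ → (Fin n → ℂ) → ℂ} (hu : HolOn ω Ω u) {t : ℂ} (ht : t ∈ ω)
    {y : Fin n → ℂ} {r : ℝ} (hy : ball y r ⊆ Ω) {N L : ℕ} {M : ℝ} (hM0 : 0 ≤ M)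
    (hM : ∀ x ∈ ball y r, ‖u t x‖ * (r - dist x y) ^ N ≤ M) (k : Fin n) (b : ℕ)
    (hL : N + b ≤ L) :
    ∀ x ∈ ball y r,
      ‖((partialX k)^[b] u) t x‖ * (r - dist x y) ^ (N + b) ≤ M * (4 * L) ^ b := by
  induction b with
  | zero => simpa using hM
  | succ b ih =>
    intro x hx
    rw [Function.iterate_succ_apply', ← add_assoc]
    refine (norm_partialX_mul_pow_le (((isTameOp_partialX hω hΩ k).iterate hω hΩ b).hol u hu) ht
      hy (ih (by omega)) k x hx).trans ?_
    have hL' : ((N + b : ℕ) : ℝ) + 1 ≤ L := by exact_mod_cast hL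
    rw [pow_succ (4 * (L : ℝ)), ← mul_assoc M]
    gcongr

/-- Nagumo's estimate for iterated partial derivatives. -/
theorem norm_partialPow_mul_pow_le {ω : Set ℂ} {Ω : Set (Fin n → ℂ)} (hω : IsOpen ω)
    (hΩ : IsOpen Ω) {u : ℂ → (Fin n → ℂ) → ℂ} (hu : HolOn ω Ω u) {t : ℂ} (ht : t ∈ ω)
    {y : Fin n → ℂ} {r : ℝ} (hy : ball y r ⊆ Ω) {N L : ℕ} {M : ℝ} (hM0 : 0 ≤ M)
    (hM : ∀ x ∈ ball y r, ‖u t x‖ * (r - dist x y) ^ N ≤ M) (α : Fin n → ℕ)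
    (hL : N + ∑ i, α i ≤ L) :
    ∀ x ∈ ball y r,
      ‖partialPow α u t x‖ * (r - dist x y) ^ (N + ∑ i, α i) ≤ M * (4 * L) ^ (∑ i, α i) := by
  rw [Fin.sum_univ_def] at *
  unfold partialPow
  suffices h : ∀ l : List (Fin n), N + (l.map α).sum ≤ L →
      HolOn ω Ω (l.foldr (fun k v => (partialX k)^[α k] v) u) ∧
      ∀ x ∈ ball y r, ‖l.foldr (fun k v => (partialX k)^[α k] v) u t x‖ *
        (r - dist x y) ^ (N + (l.map α).sum) ≤ M * (4 * L) ^ (l.map α).sum from (h _ hL).2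
  intro l
  induction l with
  | nil => exact fun _ => ⟨hu, by simpa using hM⟩
  | cons k l ih =>
    intro hL
    rw [List.map_cons, List.sum_cons] at hL ⊢
    obtain ⟨h1, h2⟩ := ih (by omega)
    refine ⟨((isTameOp_partialX hω hΩ k).iterate hω hΩ (α k)).hol _ h1, fun x hx => ?_⟩
    have h3 := norm_partialX_iterate_mul_pow_le hω hΩ h1 ht hy (by positivity) h2 k (α k)
      (L := L) (by omega) x hx
    rw [List.foldr_cons, add_comm (α k), ← add_assoc, pow_add _ (l.map α).sum, ← mul_assoc]
    exact h3

end Nagumo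

section FuchsOp

variable {n : ℕ} {ω : Set ℂ} {Ω : Set (Fin n → ℂ)}

namespace IsTameOp

variable {D D' : (ℂ → (Fin n → ℂ) → ℂ) → ℂ → (Fin n → ℂ) → ℂ}

protected theorem zero : IsTameOp ω Ω (fun (_ : ℂ → (Fin n → ℂ) → ℂ) _ _ => (0 : ℂ)) where
  hol _ _ := differentiableOn_const 0
  congr _ _ _ _ _ _ _ _ := rfl
  lin _ _ _ _ c _ _ _ _ := by simp
  series _ _ _ := ⟨fun _ _ => ⟨1, one_pos, 0, summable_zero, by simp⟩, by simp⟩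
  order _ _ _ := ⟨fun _ _ => 0, differentiableOn_const 0, by simp⟩

protected theorem add (hD : IsTameOp ω Ω D) (hD' : IsTameOp ω Ω D') :
    IsTameOp ω Ω (fun u t x => D u t x + D' u t x) where
  hol u hu := (hD.hol u hu).add (hD'.hol u hu)
  congr u v hu h t ht x hx := by
    rw [hD.congr u v hu h t ht x hx, hD'.congr u v hu h t ht x hx]
  lin u v hu hv c t ht x hx := by
    rw [hD.lin u v hu hv c t ht x hx, hD'.lin u v hu hv c t ht x hx]
    ring
  series w hw hn := by
    obtain ⟨h1, h2⟩ := hD.series w hw hn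
    obtain ⟨h3, h4⟩ := hD'.series w hw hn
    refine ⟨fun q hq => ?_, fun t ht x hx => ?_⟩
    · obtain ⟨ε, hε, c, hc, hb⟩ := h1 q hq
      obtain ⟨ε', hε', c', hc', hb'⟩ := h3 q hq
      refine ⟨min ε ε', lt_min hε hε', _, hc.add hc', fun k y hy => ?_⟩
      exact (norm_add_le _ _).trans (add_le_add
        (hb k y (ball_subset_ball (min_le_left _ _) hy))
        (hb' k y (ball_subset_ball (min_le_right _ _) hy)))
    · rw [h2 t ht x hx, h4 t ht x hx, (h1.summable ht hx).tsum_add (h3.summable ht hx)]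
  order k h hh := by
    obtain ⟨h1, h2, h3⟩ := hD.order k h hh
    obtain ⟨h4, h5, h6⟩ := hD'.order k h hh
    refine ⟨_, h2.add h5, fun t ht x hx => ?_⟩
    rw [h3 t ht x hx, h6 t ht x hx]
    ring

theorem mul_left (hω : IsOpen ω) (hΩ : IsOpen Ω) (hD : IsTameOp ω Ω D)
    {c : ℂ → (Fin n → ℂ) → ℂ} (hc : HolOn ω Ω c) :
    IsTameOp ω Ω (fun u t x => c t x * D u t x) where
  hol u hu := hc.mul (hD.hol u hu)
  congr u v hu h t ht x hx := by rw [hD.congr u v hu h t ht x hx]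
  lin u v hu hv b t ht x hx := by
    rw [hD.lin u v hu hv b t ht x hx]
    ring
  series w hw hn := by
    obtain ⟨h1, h2⟩ := hD.series w hw hn
    refine ⟨fun q hq => ?_, fun t ht x hx => by rw [h2 t ht x hx, tsum_mul_left]⟩
    obtain ⟨ε, hε, b, hb, hbb⟩ := h1 q hq
    have hcont : ContinuousAt (fun q : ℂ × (Fin n → ℂ) => ‖c q.1 q.2‖) q :=
      (DifferentiableOn.continuousOn hc).continuousAt ((hω.prod hΩ).mem_nhds hq) |>.norm
    obtain ⟨δ, hδ, hδb⟩ := Metric.eventually_nhds_iff_ball.1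
      (hcont.eventually (gt_mem_nhds (lt_add_one ‖c q.1 q.2‖)))
    refine ⟨min ε δ, lt_min hε hδ, _, hb.mul_left (‖c q.1 q.2‖ + 1), fun k y hy => ?_⟩
    rw [norm_mul]
    exact mul_le_mul (hδb y (ball_subset_ball (min_le_right _ _) hy)).le
      (hbb k y (ball_subset_ball (min_le_left _ _) hy)) (norm_nonneg _) (by positivity)
  order k h hh := by
    obtain ⟨h1, h2, h3⟩ := hD.order k h hh
    refine ⟨_, hc.mul h2, fun t ht x hx => ?_⟩
    rw [h3 t ht x hx]
    ring

protected theorem sum {ι : Type*} (s : Finset ι)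
    {F : ι → (ℂ → (Fin n → ℂ) → ℂ) → ℂ → (Fin n → ℂ) → ℂ} (hF : ∀ i ∈ s, IsTameOp ω Ω (F i)) :
    IsTameOp ω Ω (fun u t x => ∑ i ∈ s, F i u t x) := by
  classical
  induction s using Finset.induction_on with
  | empty => simpa using IsTameOp.zero
  | insert i s hi ih =>
    simp only [Finset.sum_insert hi]
    exact (hF i (by simp)).add (ih fun k hk => hF k (by simp [hk]))

end IsTameOp

theorem isTameOp_indicial (hω : IsOpen ω) (hΩ : IsOpen Ω) (p : Polynomial ℂ) :
    IsTameOp ω Ω (fun u t x =>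
      ∑ j ∈ Finset.range (p.natDegree + 1), p.coeff j * (thetaT^[j] u) t x) :=
  IsTameOp.sum _ fun j _ => ((isTameOp_thetaT hω hΩ).iterate hω hΩ j).mul_left hω hΩ
    (differentiableOn_const (p.coeff j))

/-- The operator `∑_{|α|+j ≤ m} a_{α,j}·∂_x^α θ_t^j`. -/
noncomputable def lowerOp (m : ℕ) (a : (Fin n → ℕ) → ℕ → ℂ → (Fin n → ℂ) → ℂ)
    (u : ℂ → (Fin n → ℂ) → ℂ) : ℂ → (Fin n → ℂ) → ℂ := fun t x =>
  ∑ j ∈ Finset.range (m + 1),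
    ∑ α ∈ Fintype.piFinset (fun _ : Fin n => Finset.range (m + 1)),
      if (∑ i, α i) + j ≤ m then a α j t x * (partialPow α (thetaT^[j] u)) t x else 0

theorem isTameOp_lowerOp (hω : IsOpen ω) (hΩ : IsOpen Ω) {m : ℕ}
    {a : (Fin n → ℕ) → ℕ → ℂ → (Fin n → ℂ) → ℂ}
    (ha : ∀ (α : Fin n → ℕ) (j : ℕ), (∑ i, α i) + j ≤ m → HolOn ω Ω (a α j)) :
    IsTameOp ω Ω (lowerOp m a) := by
  unfold lowerOp
  refine IsTameOp.sum _ fun j _ => IsTameOp.sum _ fun α _ => ?_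
  by_cases h : (∑ i, α i) + j ≤ m
  · simp only [if_pos h]
    exact ((isTameOp_partialPow hω hΩ α).comp hω hΩ
      ((isTameOp_thetaT hω hΩ).iterate hω hΩ j)).mul_left hω hΩ (ha α j h)
  · simpa only [if_neg h] using IsTameOp.zero

theorem isTameOp_fuchsOp (hω : IsOpen ω) (hΩ : IsOpen Ω) {m : ℕ} (p : Polynomial ℂ)
    {a : (Fin n → ℕ) → ℕ → ℂ → (Fin n → ℂ) → ℂ}
    (ha : ∀ (α : Fin n → ℕ) (j : ℕ), (∑ i, α i) + j ≤ m → HolOn ω Ω (a α j)) :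
    IsTameOp ω Ω (fuchsOp m p a) :=
  (isTameOp_indicial hω hΩ p).add
    ((isTameOp_lowerOp hω hΩ ha).mul_left hω hΩ (HolOn.of_fst differentiable_id))

theorem norm_lowerOp_mul_pow_le (hω : IsOpen ω) (hΩ : IsOpen Ω) {m : ℕ} (hm : 1 ≤ m)
    {a : (Fin n → ℕ) → ℕ → ℂ → (Fin n → ℂ) → ℂ} {A : ℝ} (hA : 0 ≤ A)
    {u : ℂ → (Fin n → ℂ) → ℂ} (hu : HolOn ω Ω u) {t : ℂ} (ht : t ∈ ω)
    {y : Fin n → ℂ} {r : ℝ} (hr : r ≤ 1) (hy : ball y r ⊆ Ω)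
    (ha : ∀ (α : Fin n → ℕ) (j : ℕ), (∑ i, α i) + j ≤ m → ∀ x ∈ ball y r, ‖a α j t x‖ ≤ A)
    {k : ℕ} (hk : 1 ≤ k) {Q : ℝ} (hQ : 0 ≤ Q)
    (hb : ∀ i j, i + j ≤ m → ∀ x ∈ ball y r,
      (k : ℝ) ^ i * ‖(thetaT^[j] u) t x‖ * (r - dist x y) ^ (m * k) ≤ Q) :
    ∀ x ∈ ball y r, ‖lowerOp m a u t x‖ * (r - dist x y) ^ (m * (k + 1)) ≤
      ((m + 1) * (m + 1) ^ n * A * (8 * m) ^ m) * Q := by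
  intro x hx
  have hk0 : (0 : ℝ) < k := by exact_mod_cast hk
  have hm1 : (1 : ℝ) ≤ m := by exact_mod_cast hm
  set d := r - dist x y with hd
  have hd0 : 0 < d := by rw [mem_ball] at hx; linarith
  have hd1 : d ≤ 1 := by linarith [dist_nonneg (x := x) (y := y)]
  have hterm : ∀ (j : ℕ) (α : Fin n → ℕ),
      ‖if (∑ i, α i) + j ≤ m then a α j t x * (partialPow α (thetaT^[j] u)) t x else 0‖ *
        d ^ (m * (k + 1)) ≤ A * (8 * m) ^ m * Q := by
    intro j α
    split_ifs with h
    · set b := ∑ i, α i with hbdef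
      have h1 := norm_partialPow_mul_pow_le hω hΩ
        (((isTameOp_thetaT hω hΩ).iterate hω hΩ j).hol u hu) ht hy (N := m * k)
        (L := 2 * m * k) (M := Q / (k : ℝ) ^ b) (by positivity) (fun x hx => by
          rw [le_div_iff₀ (by positivity)]
          calc _ = _ := by ring
            _ ≤ Q := hb b j h x hx) α (by
          have : m ≤ m * k := Nat.le_mul_of_pos_right m hk
          have : 2 * m * k = m * k + m * k := by ring
          omega) x hx
      have h2 : Q / (k : ℝ) ^ b * (4 * ((2 * m * k : ℕ) : ℝ)) ^ b = (8 * m) ^ b * Q := by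
        have : (4 * ((2 * m * k : ℕ) : ℝ)) = (8 * m) * k := by push_cast; ring
        rw [this, mul_pow]
        field_simp
      rw [h2, ← hbdef] at h1
      have h3 : (8 * (m : ℝ)) ^ b ≤ (8 * m) ^ m :=
        pow_le_pow_right₀ (by linarith) (by omega)
      have h4 : d ^ (m * (k + 1)) ≤ d ^ (m * k + b) :=
        pow_le_pow_of_le_one hd0.le hd1 (by rw [mul_add]; omega)
      rw [norm_mul]
      calc ‖a α j t x‖ * ‖partialPow α (thetaT^[j] u) t x‖ * d ^ (m * (k + 1))
          ≤ A * ‖partialPow α (thetaT^[j] u) t x‖ * d ^ (m * k + b) := by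
            gcongr
            exact ha α j h x hx
        _ = A * (‖partialPow α (thetaT^[j] u) t x‖ * d ^ (m * k + b)) := by ring
        _ ≤ A * ((8 * m) ^ m * Q) :=
            mul_le_mul_of_nonneg_left (h1.trans (mul_le_mul_of_nonneg_right h3 hQ)) hA
        _ = _ := by ring
    · simp only [norm_zero, zero_mul]
      positivity
  unfold lowerOp
  calc _ ≤ (∑ j ∈ Finset.range (m + 1),
          ∑ α ∈ Fintype.piFinset (fun _ : Fin n => Finset.range (m + 1)),
            ‖if (∑ i, α i) + j ≤ m then a α j t x * (partialPow α (thetaT^[j] u)) t x else 0‖) *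
            d ^ (m * (k + 1)) := by
        gcongr
        exact (norm_sum_le _ _).trans (Finset.sum_le_sum fun j _ => norm_sum_le _ _)
    _ ≤ ∑ j ∈ Finset.range (m + 1),
          ∑ α ∈ Fintype.piFinset (fun _ : Fin n => Finset.range (m + 1)),
            A * (8 * m) ^ m * Q := by
        simp only [Finset.sum_mul]
        exact Finset.sum_le_sum fun j _ => Finset.sum_le_sum fun α _ => hterm j α
    _ = _ := by
        simp only [Finset.sum_const, Fintype.card_piFinset, Finset.card_range, Finset.prod_const,
          Finset.card_univ, Fintype.card_fin, nsmul_eq_mul]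
        push_cast
        ring

end FuchsOp

section Existence

variable {n : ℕ}

theorem exists_majorized_step {m : ℕ} (hm : 1 ≤ m) {p : Polynomial ℂ} (hmonic : p.Monic)
    (hdeg : p.natDegree = m) (hchar : ∀ k : ℕ, p.eval (k : ℂ) ≠ 0) {A : ℝ} (hA : 0 ≤ A) :
    ∃ B ≥ (1 : ℝ), ∃ C ≥ (0 : ℝ), ∃ k₀ ≥ 1, ∀ (a : (Fin n → ℕ) → ℕ → ℂ → (Fin n → ℂ) → ℂ)
      (ω : Set ℂ) (Ω : Set (Fin n → ℂ)), IsOpen ω → IsOpen Ω →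
      (∀ t ∈ ω, ∀ σ : ℝ, 0 ≤ σ → σ ≤ 1 → (σ : ℂ) * t ∈ ω) →
      (∀ (α : Fin n → ℕ) (j : ℕ), (∑ i, α i) + j ≤ m → HolOn ω Ω (a α j)) →
      ∀ k g, HolOn ω Ω g → ∃ h g', HolOn ω Ω h ∧ HolOn ω Ω g' ∧
        (∀ t ∈ ω, ∀ x ∈ Ω, ∑ j ∈ Finset.range (p.natDegree + 1),
          p.coeff j * (thetaT^[j] (fun t x => t ^ k * h t x)) t x = t ^ k * g t x) ∧
        (∀ t ∈ ω, ∀ x ∈ Ω, t ^ (k + 1) * g' t x =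
          -(t * lowerOp m a (fun t x => t ^ k * h t x) t x)) ∧
        (k₀ ≤ k → ∀ t ∈ ω, ∀ y, ∀ r ≤ (1 : ℝ), ball y r ⊆ Ω →
          (∀ (α : Fin n → ℕ) (j : ℕ), (∑ i, α i) + j ≤ m →
            ∀ t ∈ ω, ∀ x ∈ ball y r, ‖a α j t x‖ ≤ A) →
          ∀ M ≥ (0 : ℝ), (∀ σ ∈ Ioc (0 : ℝ) 1, ∀ x ∈ ball y r,
            ‖((σ : ℂ) * t) ^ k * g (σ * t) x‖ * (r - dist x y) ^ (m * k) ≤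
              M * ‖(σ : ℂ) * t‖ ^ k) →
          ∀ σ ∈ Ioc (0 : ℝ) 1, ∀ x ∈ ball y r,
            ‖((σ : ℂ) * t) ^ k * h (σ * t) x‖ * (r - dist x y) ^ (m * k) ≤
              C * M * ‖(σ : ℂ) * t‖ ^ k ∧
            ‖((σ : ℂ) * t) ^ (k + 1) * g' (σ * t) x‖ * (r - dist x y) ^ (m * (k + 1)) ≤
              B * M * ‖(σ : ℂ) * t‖ ^ (k + 1)) := by
  obtain ⟨C, hC, k₀, hk₀, H⟩ := exists_indicial_inverse (n := n) m p hmonic hdeg hchar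
  set B₀ : ℝ := (m + 1) * (m + 1) ^ n * A * (8 * m) ^ m * C with hB₀
  refine ⟨max 1 B₀, le_max_left _ _, C, hC, k₀, hk₀, fun a ω Ω hω hΩ hstar ha k g hg => ?_⟩
  obtain ⟨h, hh, heq, hest⟩ := H ω Ω hω hΩ hstar k g hg
  obtain ⟨g', hg', heq'⟩ := (isTameOp_lowerOp hω hΩ ha).order k h hh
  refine ⟨h, fun t x => (-1) * g' t x, hh, hg'.const_mul _, heq, fun t ht x hx => ?_, ?_⟩
  · rw [heq' t ht x hx]
    ring
  intro hk t ht y r hr hy hab M hM hGM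
  have key : ∀ σ ∈ Ioc (0 : ℝ) 1, ∀ i j, i + j ≤ m → ∀ x ∈ ball y r,
      (k : ℝ) ^ i * ‖(thetaT^[j] (fun t x => t ^ k * h t x)) (σ * t) x‖ *
        (r - dist x y) ^ (m * k) ≤ C * M * ‖(σ : ℂ) * t‖ ^ k := by
    intro σ hσ i j hij x hx
    have hd : 0 < (r - dist x y) ^ (m * k) := pow_pos (by rw [mem_ball] at hx; linarith) _
    have h1 := hest hk (σ * t) (hstar t ht σ hσ.1.le hσ.2) x (hy hx)
      (M / (r - dist x y) ^ (m * k)) (fun s hs => by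
        have h2 := hGM (s * σ) ⟨mul_pos hs.1 hσ.1, mul_le_one₀ hs.2 hσ.1.le hσ.2⟩ x hx
        rw [Complex.ofReal_mul, mul_assoc] at h2
        rw [div_mul_eq_mul_div, le_div_iff₀ hd]
        exact h2) i j hij
    calc _ ≤ C * (M / (r - dist x y) ^ (m * k) * ‖(σ : ℂ) * t‖ ^ k) *
          (r - dist x y) ^ (m * k) := by gcongr
      _ = _ := by field_simp
  intro σ hσ x hx
  refine ⟨by simpa using key σ hσ 0 0 (Nat.zero_le _) x hx, ?_⟩
  have ht' := hstar t ht σ hσ.1.le hσ.2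
  have hL := norm_lowerOp_mul_pow_le hω hΩ hm hA
    ((HolOn.of_fst (c := fun t => t ^ k) (differentiable_id.pow k)).mul hh) ht' hr hy
    (fun α j hαj x hx => hab α j hαj _ ht' x hx) (hk₀.trans hk) (by positivity) (key σ hσ) x hx
  have hid : ((σ : ℂ) * t) ^ (k + 1) * (-1 * g' (σ * t) x) =
      -((σ * t) * lowerOp m a (fun t x => t ^ k * h t x) (σ * t) x) := by
    rw [heq' _ ht' x (hy hx)]
    ring
  rw [hid, norm_neg, norm_mul, mul_assoc]
  calc _ ≤ ‖(σ : ℂ) * t‖ *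
        ((m + 1) * (m + 1) ^ n * A * (8 * m) ^ m * (C * M * ‖(σ : ℂ) * t‖ ^ k)) :=
        mul_le_mul_of_nonneg_left hL (norm_nonneg _)
    _ = B₀ * M * ‖(σ : ℂ) * t‖ ^ (k + 1) := by
        rw [hB₀]
        ring
    _ ≤ _ := by
        gcongr
        exact le_max_right _ _

theorem exists_uniform_bound {m : ℕ} {a : (Fin n → ℕ) → ℕ → ℂ → (Fin n → ℂ) → ℂ}
    {K : Set (ℂ × (Fin n → ℂ))} (hK : IsCompact K)
    (ha : ∀ (α : Fin n → ℕ) (j : ℕ), (∑ i, α i) + j ≤ m →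
      ContinuousOn (fun q : ℂ × (Fin n → ℂ) => a α j q.1 q.2) K) :
    ∃ A ≥ (0 : ℝ), ∀ (α : Fin n → ℕ) (j : ℕ), (∑ i, α i) + j ≤ m →
      ∀ q ∈ K, ‖a α j q.1 q.2‖ ≤ A := by
  have h : ∀ (α : Fin n → ℕ) (j : ℕ), ∃ b ≥ (0 : ℝ), (∑ i, α i) + j ≤ m →
      ∀ q ∈ K, ‖a α j q.1 q.2‖ ≤ b := by
    intro α j
    by_cases hαj : (∑ i, α i) + j ≤ m
    · obtain ⟨b, hb⟩ := hK.exists_bound_of_continuousOn (ha α j hαj)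
      exact ⟨max b 0, le_max_right _ _, fun _ q hq => (hb q hq).trans (le_max_left _ _)⟩
    · exact ⟨0, le_rfl, fun h => absurd h hαj⟩
  choose b hb0 hb using h
  refine ⟨∑ α ∈ Fintype.piFinset (fun _ : Fin n => Finset.range (m + 1)),
    ∑ j ∈ Finset.range (m + 1), b α j,
    Finset.sum_nonneg fun α _ => Finset.sum_nonneg fun j _ => hb0 α j, fun α j hαj q hq => ?_⟩
  have hα : α ∈ Fintype.piFinset (fun _ : Fin n => Finset.range (m + 1)) := by
    refine Fintype.mem_piFinset.2 fun i => Finset.mem_range.2 ?_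
    have := Finset.single_le_sum (f := α) (fun _ _ => Nat.zero_le _) (Finset.mem_univ i)
    omega
  calc ‖a α j q.1 q.2‖ ≤ b α j := hb α j hαj q hq
    _ ≤ ∑ j ∈ Finset.range (m + 1), b α j :=
      Finset.single_le_sum (f := fun j => b α j) (fun j _ => hb0 α j)
        (Finset.mem_range.2 (by omega))
    _ ≤ _ := Finset.single_le_sum (f := fun α => ∑ j ∈ Finset.range (m + 1), b α j)
        (fun α _ => Finset.sum_nonneg fun j _ => hb0 α j) hα

/-- A series solution whose terms satisfy the recursion `p(θ_t) w_k = G_k`,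
`G_{k+1} = G_k - P w_k`, sums to a solution of `P u = G_0`. -/
theorem fuchsOp_tsum_eq {m : ℕ} {p : Polynomial ℂ} {ω : Set ℂ} {Ω : Set (Fin n → ℂ)}
    (hω : IsOpen ω) (hΩ : IsOpen Ω) {a : (Fin n → ℕ) → ℕ → ℂ → (Fin n → ℂ) → ℂ}
    (ha : ∀ (α : Fin n → ℕ) (j : ℕ), (∑ i, α i) + j ≤ m → HolOn ω Ω (a α j))
    {w G : ℕ → ℂ → (Fin n → ℂ) → ℂ} (hw : ∀ k, HolOn ω Ω (w k)) (hn : NormalOn ω Ω w)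
    (hG : ∀ k, ∀ t ∈ ω, ∀ x ∈ Ω, ∑ j ∈ Finset.range (p.natDegree + 1),
      p.coeff j * (thetaT^[j] (w k)) t x = G k t x)
    (hG' : ∀ k, ∀ t ∈ ω, ∀ x ∈ Ω, G (k + 1) t x = -(t * lowerOp m a (w k) t x))
    {t : ℂ} (ht : t ∈ ω) {x : Fin n → ℂ} (hx : x ∈ Ω) :
    fuchsOp m p a (fun t x => ∑' k, w k t x) t x = G 0 t x := by
  obtain ⟨h1, h2⟩ := (isTameOp_fuchsOp hω hΩ p ha).series w hw hn
  rw [h2 t ht x hx]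
  have hsum := h1.summable ht hx
  have hGsum : Summable fun k => G k t x := by
    refine (((isTameOp_indicial hω hΩ p).series w hw hn).1.summable ht hx).congr fun k => ?_
    exact hG k t ht x hx
  have hdiff : ∀ k, fuchsOp m p a (w k) t x = G k t x - G (k + 1) t x := by
    intro k
    rw [hG' k t ht x hx, sub_neg_eq_add, ← hG k t ht x hx]
    rfl
  refine tendsto_nhds_unique hsum.hasSum.tendsto_sum_nat ?_
  simp only [hdiff, Finset.sum_range_sub']
  simpa using (tendsto_const_nhds (x := G 0 t x)).sub hGsum.tendsto_atTop_zero

theorem exists_recursion {S : Type*} {P : S → Prop} {Q : ℕ → S → S → S → Prop}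
    (h : ∀ k g, P g → ∃ u g', P u ∧ P g' ∧ Q k g u g') {f : S} (hf : P f) :
    ∃ u g : ℕ → S, g 0 = f ∧ (∀ k, P (u k)) ∧ (∀ k, P (g k)) ∧ ∀ k, Q k (g k) (u k) (g (k + 1)) := by
  choose! u g' hu hg' hQ using h
  let s : ℕ → S := fun k => Nat.rec f g' k
  have hs : ∀ k, P (s k) := by
    intro k
    induction k with
    | zero => exact hf
    | succ k ih => exact hg' k _ ih
  exact ⟨fun k => u k (s k), s, rfl, fun k => hu k _ (hs k), hs, fun k => hQ k _ (hs k)⟩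

theorem exists_fuchsOp_eq {m : ℕ} (hm : 1 ≤ m) {ρ₁ : ℝ} (hρ₁ : 0 < ρ₁)
    {Ω Ω₁ : Set (Fin n → ℂ)} (hΩ : IsOpen Ω) (hΩb : Bornology.IsBounded Ω)
    (hΩ₁ : IsOpen Ω₁) (hcl : closure Ω ⊆ Ω₁)
    {p : Polynomial ℂ} (hmonic : p.Monic) (hdeg : p.natDegree = m)
    (hchar : ∀ k : ℕ, p.eval (k : ℂ) ≠ 0)
    {a : (Fin n → ℕ) → ℕ → ℂ → (Fin n → ℂ) → ℂ}
    (ha : ∀ (α : Fin n → ℕ) (j : ℕ), (∑ i, α i) + j ≤ m → HolOn (ball (0 : ℂ) ρ₁) Ω₁ (a α j)) :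
    ∃ ρ : ℝ, 0 < ρ ∧ ρ < ρ₁ ∧ ∀ ω : Set ℂ, IsOpen ω → ω ⊆ ball (0 : ℂ) ρ →
      (∀ t ∈ ω, ∀ σ : ℝ, 0 ≤ σ → σ ≤ 1 → (σ : ℂ) * t ∈ ω) →
      ∀ f : ℂ → (Fin n → ℂ) → ℂ, HolOn ω Ω₁ f →
        ∃ u, HolOn ω Ω u ∧ ∀ t ∈ ω, ∀ x ∈ Ω, fuchsOp m p a u t x = f t x := by
  obtain ⟨δ, hδ, hδΩ⟩ := hΩb.isCompact_closure.exists_cthickening_subset_open hΩ₁ hcl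
  set r : ℝ := min δ 1 with hr
  have hr0 : 0 < r := lt_min hδ one_pos
  have hr1 : r ≤ 1 := min_le_right _ _
  have hcb : ∀ y ∈ Ω, closedBall y r ⊆ cthickening δ (closure Ω) := fun y hy =>
    (closedBall_subset_closedBall (min_le_left _ _)).trans
      (closedBall_subset_cthickening (subset_closure hy) δ)
  have hΩΩ₁ : Ω ⊆ Ω₁ := subset_closure.trans hcl
  obtain ⟨A, hA, hAb⟩ := exists_uniform_bound (a := a)
    ((isCompact_closedBall (0 : ℂ) (ρ₁ / 2)).prod (hΩb.isCompact_closure.cthickening (r := δ)))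
    fun α j hαj => (DifferentiableOn.continuousOn (ha α j hαj)).mono
      (prod_mono (closedBall_subset_ball (by linarith)) hδΩ)
  obtain ⟨B, hB, C, hC, k₀, hk₀, H⟩ :=
    exists_majorized_step (n := n) hm hmonic hdeg hchar hA
  have hden : 0 < 2 * B * (2 / r) ^ m := by positivity
  refine ⟨min (ρ₁ / 2) (1 / (2 * B * (2 / r) ^ m)), lt_min (by linarith) (by positivity),
    (min_le_left _ _).trans_lt (by linarith), fun ω hω hωρ hstar f hf => ?_⟩
  have hω₁ : ω ⊆ closedBall 0 (ρ₁ / 2) :=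
    hωρ.trans ((ball_subset_ball (min_le_left _ _)).trans ball_subset_closedBall)
  have ha₁ : ∀ (α : Fin n → ℕ) (j : ℕ), (∑ i, α i) + j ≤ m → HolOn ω Ω₁ (a α j) :=
    fun α j hαj => (ha α j hαj).mono (hω₁.trans (closedBall_subset_ball (by linarith)))
      subset_rfl
  obtain ⟨h, g, hg0, hh, hg, hstep⟩ :=
    exists_recursion (P := HolOn ω Ω₁) (H a ω Ω₁ hω hΩ₁ hstar ha₁) hf
  have hw : ∀ k, HolOn ω Ω₁ (fun t x => t ^ k * h k t x) := fun k =>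
    (HolOn.of_fst (c := fun t => t ^ k) (differentiable_id.pow k)).mul (hh k)
  have hnormal : NormalOn ω Ω (fun k t x => t ^ k * h k t x) := by
    rintro ⟨t₀, y⟩ ⟨ht₀, hy⟩
    simp only at ht₀ hy
    obtain ⟨ε, hε, hεω⟩ := Metric.nhds_basis_closedBall.mem_iff.1 (hω.mem_nhds ht₀)
    have hyΩ₁ : closedBall y r ⊆ Ω₁ := (hcb y hy).trans hδΩ
    set K : Set ℂ := (fun q : ℝ × ℂ => (q.1 : ℂ) * q.2) '' (Icc (0 : ℝ) 1 ×ˢ closedBall t₀ ε)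
      with hK
    have hKc : IsCompact K :=
      (isCompact_Icc.prod (isCompact_closedBall t₀ ε)).image (by fun_prop)
    have hKω : K ⊆ ω := by
      rintro _ ⟨⟨σ, t⟩, ⟨hσ, ht⟩, rfl⟩
      exact hstar t (hεω ht) σ hσ.1 hσ.2
    have hcomp : ∀ v, HolOn ω Ω₁ v → ∃ M ≥ (0 : ℝ), ∀ t ∈ K, ∀ x ∈ closedBall y r,
        ‖v t x‖ ≤ M := by
      intro v hv
      obtain ⟨M, hM⟩ := (hKc.prod (isCompact_closedBall y r)).exists_bound_of_continuousOn
        ((DifferentiableOn.continuousOn hv).mono (prod_mono hKω hyΩ₁))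
      exact ⟨max M 0, le_max_right _ _, fun t ht x hx =>
        (hM (t, x) ⟨ht, hx⟩).trans (le_max_left _ _)⟩
    obtain ⟨M, hM0, hM⟩ := hcomp _ (hg k₀)
    have hgrow : ∀ t ∈ closedBall t₀ ε, ∀ e : ℕ, ∀ σ ∈ Ioc (0 : ℝ) 1, ∀ x ∈ ball y r,
        ‖((σ : ℂ) * t) ^ (k₀ + e) * g (k₀ + e) (σ * t) x‖ * (r - dist x y) ^ (m * (k₀ + e)) ≤
          B ^ e * M * ‖(σ : ℂ) * t‖ ^ (k₀ + e) := by
      intro t ht e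
      induction e with
      | zero =>
        intro σ hσ x hx
        have hx' : 0 < r - dist x y := by rw [mem_ball] at hx; linarith
        have h1 : (r - dist x y) ^ (m * (k₀ + 0)) ≤ 1 :=
          pow_le_one₀ hx'.le (by linarith [dist_nonneg (x := x) (y := y)])
        have h2 := hM (σ * t) ⟨(σ, t), ⟨⟨hσ.1.le, hσ.2⟩, ht⟩, rfl⟩ x (ball_subset_closedBall hx)
        rw [norm_mul, norm_pow]
        calc _ ≤ ‖(σ : ℂ) * t‖ ^ (k₀ + 0) * M * 1 := by
              gcongr
              exact h2
          _ = _ := by ring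
      | succ e ih =>
        intro σ hσ x hx
        refine ((hstep (k₀ + e)).2.2 (by omega) t (hεω ht) y r hr1
          (ball_subset_closedBall.trans hyΩ₁) (fun α j hαj t ht x hx => hAb α j hαj (t, x)
            ⟨hω₁ ht, hcb y hy (ball_subset_closedBall hx)⟩) _ (by positivity) ih
          σ hσ x hx).2.trans_eq ?_
        rw [pow_succ B]
        ring
    have hgeom : ∀ t ∈ closedBall t₀ ε, ∀ x ∈ ball y (r / 2), ∀ k ≥ k₀,
        ‖t ^ k * h k t x‖ ≤ C * M * (1 / 2) ^ k := by
      intro t ht x hx k hk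
      obtain ⟨e, rfl⟩ := Nat.exists_eq_add_of_le hk
      have hxr : x ∈ ball y r := ball_subset_ball (by linarith) hx
      have h1 := ((hstep (k₀ + e)).2.2 (by omega) t (hεω ht) y r hr1
          (ball_subset_closedBall.trans hyΩ₁) (fun α j hαj t ht x hx => hAb α j hαj (t, x)
            ⟨hω₁ ht, hcb y hy (ball_subset_closedBall hx)⟩) _ (by positivity) (hgrow t ht e)
          1 (by simp) x hxr).1
      simp only [Complex.ofReal_one, one_mul] at h1
      have hd : r / 2 ≤ r - dist x y := by rw [mem_ball] at hx; linarith
      have htn : ‖t‖ ≤ 1 / (2 * B * (2 / r) ^ m) := by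
        have := hωρ (hεω ht)
        rw [mem_ball_zero_iff] at this
        exact this.le.trans (min_le_right _ _)
      have h2 : ‖t ^ (k₀ + e) * h (k₀ + e) t x‖ * ((r / 2) ^ m) ^ (k₀ + e) ≤
          C * M * (B * ‖t‖) ^ (k₀ + e) := by
        calc _ ≤ ‖t ^ (k₀ + e) * h (k₀ + e) t x‖ * (r - dist x y) ^ (m * (k₀ + e)) := by
              rw [← pow_mul]
              gcongr
          _ ≤ C * (B ^ e * M) * ‖t‖ ^ (k₀ + e) := h1
          _ ≤ C * (B ^ (k₀ + e) * M) * ‖t‖ ^ (k₀ + e) := by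
              gcongr
              omega
          _ = _ := by ring
      have h3 : B * ‖t‖ ≤ 1 / 2 * (r / 2) ^ m := by
        calc B * ‖t‖ ≤ B * (1 / (2 * B * (2 / r) ^ m)) := by gcongr
          _ = _ := by
            rw [div_pow, div_pow]
            field_simp
      have hrm : 0 < ((r / 2) ^ m) ^ (k₀ + e) := by positivity
      refine le_of_mul_le_mul_right (h2.trans ?_) hrm
      rw [mul_assoc (C * M), ← mul_pow]
      gcongr
    choose b hb0 hb using fun k => hcomp _ (hw k)
    refine ⟨min ε (r / 2), by positivity,
      fun k => if k < k₀ then b k else C * M * (1 / 2) ^ k, ?_, fun k q hq => ?_⟩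
    · refine (summable_nat_add_iff k₀).1 ?_
      simp only [not_lt.2 (Nat.le_add_left k₀ _), if_false]
      exact ((summable_nat_add_iff k₀).2 summable_geometric_two).mul_left (C * M)
    · rw [← ball_prod_same] at hq
      have hq1 : q.1 ∈ closedBall t₀ ε :=
        ball_subset_closedBall (ball_subset_ball (min_le_left _ _) hq.1)
      have hq2 : q.2 ∈ ball y (r / 2) := ball_subset_ball (min_le_right _ _) hq.2
      simp only
      split_ifs with hk
      · exact hb k q.1 ⟨(1, q.1), ⟨by simp, hq1⟩, by simp⟩ q.2
          (ball_subset_closedBall (ball_subset_ball (by linarith) hq2))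
      · exact hgeom q.1 hq1 q.2 hq2 k (not_lt.1 hk)
  have hw' : ∀ k, HolOn ω Ω (fun t x => t ^ k * h k t x) := fun k => (hw k).mono subset_rfl hΩΩ₁
  refine ⟨_, HolOn.tsum hω hΩ hw' hnormal, fun t ht x hx => ?_⟩
  rw [fuchsOp_tsum_eq hω hΩ (fun α j hαj => (ha₁ α j hαj).mono subset_rfl hΩΩ₁) hw' hnormal
    (G := fun k t x => t ^ k * g k t x) (fun k t ht x hx => (hstep k).1 t ht x (hΩΩ₁ hx))
    (fun k t ht x hx => (hstep k).2.1 t ht x (hΩΩ₁ hx)) ht hx, hg0]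
  simp

end Existence

section Uniqueness

variable {n : ℕ} {ω : Set ℂ} {Ω : Set (Fin n → ℂ)}

theorem HolOn.differentiableOn_left {u : ℂ → (Fin n → ℂ) → ℂ} (hu : HolOn ω Ω u)
    {x : Fin n → ℂ} (hx : x ∈ Ω) : DifferentiableOn ℂ (fun t => u t x) ω :=
  DifferentiableOn.comp (g := fun q : ℂ × (Fin n → ℂ) => u q.1 q.2) hu
    (differentiable_id.prodMk (differentiable_const x)).differentiableOn fun _ ht => ⟨ht, hx⟩

theorem isPreconnected_of_star (hstar : ∀ t ∈ ω, ∀ σ : ℝ, 0 ≤ σ → σ ≤ 1 → (σ : ℂ) * t ∈ ω)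
    (h0 : (0 : ℂ) ∈ ω) : IsPreconnected ω :=
  (StarConvex.isPathConnected (starConvex_zero_iff.2 fun t ht σ hσ0 hσ1 => by
    simpa using hstar t ht σ hσ0 hσ1) h0).isConnected.isPreconnected

theorem exists_eq_mul_of_eq_zero (hω : IsOpen ω) (hΩ : IsOpen Ω)
    (hstar : ∀ t ∈ ω, ∀ σ : ℝ, 0 ≤ σ → σ ≤ 1 → (σ : ℂ) * t ∈ ω) (h0 : (0 : ℂ) ∈ ω)
    {h : ℂ → (Fin n → ℂ) → ℂ} (hh : HolOn ω Ω h) (hz : ∀ x ∈ Ω, h 0 x = 0) :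
    ∃ h', HolOn ω Ω h' ∧ ∀ t ∈ ω, ∀ x ∈ Ω, h t x = t * h' t x := by
  have hg : HolOn ω Ω (fun t x => fderiv ℂ (fun q : ℂ × (Fin n → ℂ) => h q.1 q.2) (t, x) (1, 0)) :=
    differentiableOn_fderiv_apply (hω.prod hΩ) hh (1, 0)
  obtain ⟨hH, hHeq⟩ := thetaT_integral hω hΩ hstar (μ := -1) (by simp) hg
  refine ⟨_, hH, fun t ht x hx => ?_⟩
  set H := fun (t : ℂ) (x : Fin n → ℂ) => ∫ σ in (0 : ℝ)..1, (σ : ℂ) ^ (-(-1 : ℂ) - 1) *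
    fderiv ℂ (fun q : ℂ × (Fin n → ℂ) => h q.1 q.2) (σ * t, x) (1, 0)
  have hHd := hH.differentiableOn_left hx
  have hhd := hh.differentiableOn_left hx
  have hconst := hω.is_const_of_deriv_eq_zero (isPreconnected_of_star hstar h0)
    (f := fun s => h s x - s * H s x) (hhd.sub (differentiableOn_id.mul hHd))
    (fun s hs => ?_) ht h0
  · simp only [hz x hx, zero_mul, sub_zero] at hconst
    exact sub_eq_zero.1 hconst
  · have hinc : HasDerivAt (fun τ : ℂ => (τ, x)) (1, 0) s :=
      (hasDerivAt_id s).prodMk (hasDerivAt_const s x)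
    have hf := (DifferentiableOn.differentiableAt hh ((hω.prod hΩ).mem_nhds
        (⟨hs, hx⟩ : (s, x) ∈ ω ×ˢ Ω))).hasFDerivAt
    have h1 : HasDerivAt (fun s => h s x)
        (fderiv ℂ (fun q : ℂ × (Fin n → ℂ) => h q.1 q.2) (s, x) (1, 0)) s :=
      (hf.comp_hasDerivAt s hinc :)
    have h2 := (hHd.differentiableAt (hω.mem_nhds hs)).hasDerivAt
    have h3 : s * deriv (fun τ => H τ x) s = -1 * H s x +
        fderiv ℂ (fun q : ℂ × (Fin n → ℂ) => h q.1 q.2) (s, x) (1, 0) := hHeq s hs x hx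
    have h4 : deriv (fun s => h s x - s * H s x) s = _ :=
      (h1.sub ((hasDerivAt_id s).mul h2)).deriv
    rw [h4]
    simp only [id, Pi.zero_apply]
    linear_combination -h3

theorem exists_thetaT_iterate_pow_mul (hω : IsOpen ω) (hΩ : IsOpen Ω)
    {h : ℂ → (Fin n → ℂ) → ℂ} (hh : HolOn ω Ω h) (k j : ℕ) :
    ∃ h', HolOn ω Ω h' ∧ (∀ t ∈ ω, ∀ x ∈ Ω,
      (thetaT^[j] (fun t x => t ^ k * h t x)) t x = t ^ k * h' t x) ∧
      ∀ x ∈ Ω, h' 0 x = k ^ j * h 0 x := by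
  induction j with
  | zero => exact ⟨h, hh, by simp, by simp⟩
  | succ j ih =>
    obtain ⟨h', h1, h2, h3⟩ := ih
    have hθ := isTameOp_thetaT (n := n) hω hΩ
    refine ⟨fun t x => k * h' t x + thetaT h' t x, (h1.const_mul _).add (hθ.hol _ h1),
      fun t ht x hx => ?_, fun x hx => ?_⟩
    · rw [Function.iterate_succ_apply', ← thetaT_pow_mul hω hΩ h1 k ht hx]
      exact hθ.congr _ _ ((HolOn.of_fst (c := fun t => t ^ k) (differentiable_id.pow k)).mul h1)
        h2 t ht x hx
    · simp only [thetaT, h3 x hx]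
      ring

variable {m : ℕ} {p : Polynomial ℂ} {a : (Fin n → ℕ) → ℕ → ℂ → (Fin n → ℂ) → ℂ}

theorem exists_eq_pow_mul_of_fuchsOp_eq_zero (hω : IsOpen ω) (hΩ : IsOpen Ω)
    (hstar : ∀ t ∈ ω, ∀ σ : ℝ, 0 ≤ σ → σ ≤ 1 → (σ : ℂ) * t ∈ ω) (h0 : (0 : ℂ) ∈ ω)
    (ha : ∀ (α : Fin n → ℕ) (j : ℕ), (∑ i, α i) + j ≤ m → HolOn ω Ω (a α j))
    (hchar : ∀ k : ℕ, p.eval (k : ℂ) ≠ 0) {v : ℂ → (Fin n → ℂ) → ℂ} (hv : HolOn ω Ω v)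
    (hPv : ∀ t ∈ ω, ∀ x ∈ Ω, fuchsOp m p a v t x = 0) (k : ℕ) :
    ∃ h, HolOn ω Ω h ∧ ∀ t ∈ ω, ∀ x ∈ Ω, v t x = t ^ k * h t x := by
  induction k with
  | zero => exact ⟨v, hv, by simp⟩
  | succ k ih =>
    obtain ⟨h, hh, hvh⟩ := ih
    suffices hz : ∀ x ∈ Ω, h 0 x = 0 by
      obtain ⟨h', hh', hhh'⟩ := exists_eq_mul_of_eq_zero hω hΩ hstar h0 hh hz
      refine ⟨h', hh', fun t ht x hx => ?_⟩
      rw [hvh t ht x hx, hhh' t ht x hx]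
      ring
    have hkh : HolOn ω Ω (fun t x => t ^ k * h t x) :=
      (HolOn.of_fst (c := fun t => t ^ k) (differentiable_id.pow k)).mul hh
    choose H hH hHeq hH0 using exists_thetaT_iterate_pow_mul hω hΩ hh k
    obtain ⟨R, hR, hReq⟩ := (isTameOp_lowerOp hω hΩ ha).order k h hh
    set E : ℂ → (Fin n → ℂ) → ℂ := fun t x =>
      (∑ j ∈ Finset.range (p.natDegree + 1), p.coeff j * H j t x) + t * R t x with hE
    have hEhol : HolOn ω Ω E := (HolOn.sum fun j _ => (hH j).const_mul _).add
      ((HolOn.of_fst differentiable_id).mul hR)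
    have hEeq : ∀ t ∈ ω, ∀ x ∈ Ω, t ^ k * E t x = 0 := by
      intro t ht x hx
      rw [← hPv t ht x hx, (isTameOp_fuchsOp hω hΩ p ha).congr _ v hkh hvh t ht x hx]
      change _ = _ + t * lowerOp m a (fun t x => t ^ k * h t x) t x
      rw [hReq t ht x hx, hE]
      simp only [hHeq _ t ht x hx, mul_add, Finset.mul_sum]
      congr 1
      · exact Finset.sum_congr rfl fun j _ => by ring
      · ring
    intro x hx
    have hE0 : E 0 x = 0 := by
      have hcont : ContinuousAt (fun t => E t x) 0 :=
        (hEhol.differentiableOn_left hx).continuousOn.continuousAt (hω.mem_nhds h0)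
      have hev : (fun t => E t x) =ᶠ[𝓝[≠] 0] fun _ => 0 := by
        filter_upwards [self_mem_nhdsWithin, mem_nhdsWithin_of_mem_nhds (hω.mem_nhds h0)]
          with t ht0 ht
        exact (mul_eq_zero.1 (hEeq t ht x hx)).resolve_left (pow_ne_zero k ht0)
      exact tendsto_nhds_unique (hcont.tendsto.mono_left nhdsWithin_le_nhds)
        (tendsto_const_nhds.congr' hev.symm)
    have hE0' : E 0 x = p.eval (k : ℂ) * h 0 x := by
      rw [Polynomial.eval_eq_sum_range, Finset.sum_mul]
      simp only [hE, zero_mul, add_zero, hH0 _ x hx, mul_assoc]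
    exact (mul_eq_zero.1 (hE0'.symm.trans hE0)).resolve_left (hchar k)

theorem eq_zero_of_fuchsOp_eq_zero (hω : IsOpen ω) (hΩ : IsOpen Ω)
    (hstar : ∀ t ∈ ω, ∀ σ : ℝ, 0 ≤ σ → σ ≤ 1 → (σ : ℂ) * t ∈ ω)
    (ha : ∀ (α : Fin n → ℕ) (j : ℕ), (∑ i, α i) + j ≤ m → HolOn ω Ω (a α j))
    (hchar : ∀ k : ℕ, p.eval (k : ℂ) ≠ 0) {v : ℂ → (Fin n → ℂ) → ℂ} (hv : HolOn ω Ω v)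
    (hPv : ∀ t ∈ ω, ∀ x ∈ Ω, fuchsOp m p a v t x = 0) :
    ∀ t ∈ ω, ∀ x ∈ Ω, v t x = 0 := by
  intro t ht x hx
  have h0 : (0 : ℂ) ∈ ω := by simpa using hstar t ht 0 le_rfl zero_le_one
  have hvan : AnalyticOnNhd ℂ (fun t => v t x) ω := (hv.differentiableOn_left hx).analyticOnNhd hω
  refine hvan.eqOn_zero_of_preconnected_of_eventuallyEq_zero (isPreconnected_of_star hstar h0) h0
    (analyticOrderAt_eq_top.1 (ENat.eq_top_iff_forall_ge.2 fun k => ?_)) ht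
  obtain ⟨h, hh, hvh⟩ := exists_eq_pow_mul_of_fuchsOp_eq_zero hω hΩ hstar h0 ha hchar hv hPv k
  refine (natCast_le_analyticOrderAt (hvan 0 h0)).2
    ⟨_, (hh.differentiableOn_left hx).analyticOnNhd hω 0 h0, ?_⟩
  filter_upwards [hω.mem_nhds h0] with s hs
  simpa using hvh s hs x hx

theorem eq_of_fuchsOp_eq (hω : IsOpen ω) (hΩ : IsOpen Ω)
    (hstar : ∀ t ∈ ω, ∀ σ : ℝ, 0 ≤ σ → σ ≤ 1 → (σ : ℂ) * t ∈ ω)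
    (ha : ∀ (α : Fin n → ℕ) (j : ℕ), (∑ i, α i) + j ≤ m → HolOn ω Ω (a α j))
    (hchar : ∀ k : ℕ, p.eval (k : ℂ) ≠ 0) {u v : ℂ → (Fin n → ℂ) → ℂ} (hu : HolOn ω Ω u)
    (hv : HolOn ω Ω v)
    (huv : ∀ t ∈ ω, ∀ x ∈ Ω, fuchsOp m p a v t x = fuchsOp m p a u t x) :
    ∀ t ∈ ω, ∀ x ∈ Ω, v t x = u t x := by
  intro t ht x hx
  have h := eq_zero_of_fuchsOp_eq_zero hω hΩ hstar ha hchar ((hu.const_mul (-1)).add hv)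
    (fun t ht x hx => by
      rw [(isTameOp_fuchsOp hω hΩ p ha).lin u v hu hv (-1) t ht x hx, huv t ht x hx]
      ring) t ht x hx
  linear_combination h

end Uniqueness

end

/-- Existence and uniqueness of holomorphic solutions of Fuchsian type equations
`Pu = f` near the hypersurface `t = 0`, when no non-negative integer is a
characteristic exponent (Baouendi–Goulaouic / Proposition on holomorphic solutions). -/
theorem statement5 (m n : ℕ) (hm : 1 ≤ m) (ρ₁ : ℝ) (hρ₁ : 0 < ρ₁)
    (Ω Ω₁ : Set (Fin n → ℂ)) (hΩ : IsOpen Ω) (hΩb : Bornology.IsBounded Ω)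
    (hΩ₁ : IsOpen Ω₁) (hcl : closure Ω ⊆ Ω₁)
    (p : Polynomial ℂ) (hmonic : p.Monic) (hdeg : p.natDegree = m)
    (hchar : ∀ k : ℕ, p.eval (k : ℂ) ≠ 0)
    (a : (Fin n → ℕ) → ℕ → ℂ → (Fin n → ℂ) → ℂ)
    (ha : ∀ (α : Fin n → ℕ) (j : ℕ), (∑ i, α i) + j ≤ m →
      DifferentiableOn ℂ (fun q : ℂ × (Fin n → ℂ) => a α j q.1 q.2)
        ((Metric.ball (0 : ℂ) ρ₁) ×ˢ Ω₁)) :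
    ∃ ρ : ℝ, 0 < ρ ∧ ρ < ρ₁ ∧
      ∀ ω : Set ℂ, IsOpen ω → ω ⊆ Metric.ball (0 : ℂ) ρ →
        (∀ t ∈ ω, ∀ σ : ℝ, 0 ≤ σ → σ ≤ 1 → (σ : ℂ) * t ∈ ω) →
        ∀ f : ℂ → (Fin n → ℂ) → ℂ,
          DifferentiableOn ℂ (fun q : ℂ × (Fin n → ℂ) => f q.1 q.2) (ω ×ˢ Ω₁) →
          ∃ u : ℂ → (Fin n → ℂ) → ℂ,
            (DifferentiableOn ℂ (fun q : ℂ × (Fin n → ℂ) => u q.1 q.2) (ω ×ˢ Ω) ∧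
              ∀ t ∈ ω, ∀ x ∈ Ω, fuchsOp m p a u t x = f t x) ∧
            ∀ v : ℂ → (Fin n → ℂ) → ℂ,
              (DifferentiableOn ℂ (fun q : ℂ × (Fin n → ℂ) => v q.1 q.2) (ω ×ˢ Ω) ∧
                ∀ t ∈ ω, ∀ x ∈ Ω, fuchsOp m p a v t x = f t x) →
              ∀ t ∈ ω, ∀ x ∈ Ω, v t x = u t x := by
  obtain ⟨ρ, hρ, hρρ₁, H⟩ := exists_fuchsOp_eq hm hρ₁ hΩ hΩb hΩ₁ hcl hmonic hdeg hchar ha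
  refine ⟨ρ, hρ, hρρ₁, fun ω hω hωρ hstar f hf => ?_⟩
  obtain ⟨u, hu, hPu⟩ := H ω hω hωρ hstar f hf
  refine ⟨u, ⟨hu, hPu⟩, fun v hv => ?_⟩
  exact eq_of_fuchsOp_eq hω hΩ hstar
    (fun α j hαj => HolOn.mono (ha α j hαj) (hωρ.trans (Metric.ball_subset_ball hρρ₁.le))
      (subset_closure.trans hcl)) hchar hu hv.1
    fun t ht x hx => (hv.2 t ht x hx).trans (hPu t ht x hx).symm
end
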